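/- arXiv:2001.05138 — 4 statements merged into one kernel-verified Lean document; each statement's English description precedes it below -/
import Mathlib

section
/- Let G be a connected graph of size q (i.e. with q edges) containing exactly k pendant vertices, and let f be a local antimagic labeling of G. If the edge e₀ with f(e₀) = q is not a pendant edge (i.e. neither endpoint of e₀ is a pendant vertex), then the color number of f satisfies c(f) ≥ k + 2. -/
open Finset
open scoped Classical

namespace LocalAntimagic

variable {V : Type*}

/-- The induced vertex label: sum of the labels of edges incident to `v`. -/
noncomputable def vertexSum [Fintype V] (G : SimpleGraph V) (f : Sym2 V → ℕ) (v : V) : ℕ :=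
  ∑ e ∈ G.incidenceFinset v, f e

/-- `f` is a local antimagic labeling of `G`: a bijection from the edge set onto
`{1, …, |E|}` whose induced vertex labels distinguish adjacent vertices. -/
def IsLocalAntimagic [Fintype V] (G : SimpleGraph V) (f : Sym2 V → ℕ) : Prop :=
  Set.BijOn f G.edgeSet (Set.Icc 1 G.edgeFinset.card) ∧
  ∀ ⦃u v : V⦄, G.Adj u v → vertexSum G f u ≠ vertexSum G f v

/-- The color number `c(f)`: the number of distinct induced vertex labels. -/
noncomputable def colorCount [Fintype V] (G : SimpleGraph V) (f : Sym2 V → ℕ) : ℕ :=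
  (Finset.univ.image (vertexSum G f)).card

/-- The local antimagic chromatic number. -/
noncomputable def chiLA [Fintype V] (G : SimpleGraph V) : ℕ :=
  sInf {n | ∃ f, IsLocalAntimagic G f ∧ colorCount G f = n}

/-- A pendant vertex is a vertex of degree 1. -/
def IsPendant [Fintype V] (G : SimpleGraph V) (v : V) : Prop :=
  G.degree v = 1

/-- The number of pendant vertices of `G`. -/
noncomputable def pendantCount [Fintype V] (G : SimpleGraph V) : ℕ :=
  (Finset.univ.filter (fun v => IsPendant G v)).card

/-- A pendant vertex is labelled by the label of its unique incident edge. -/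
lemma IsPendant.exists_vertexSum_eq [Fintype V] {G : SimpleGraph V} (f : Sym2 V → ℕ) {v : V}
    (hv : IsPendant G v) : ∃ e ∈ G.edgeSet, v ∈ e ∧ vertexSum G f v = f e := by
  rw [IsPendant, ← G.card_incidenceFinset_eq_degree, Finset.card_eq_one] at hv
  obtain ⟨e, he⟩ := hv
  have hmem : e ∈ G.incidenceFinset v := by simp [he]
  rw [SimpleGraph.mem_incidenceFinset] at hmem
  exact ⟨e, hmem.1, hmem.2, by simp [vertexSum, he]⟩

/-- Distinct pendant vertices receive distinct labels. -/
lemma IsLocalAntimagic.injOn_vertexSum [Fintype V] {G : SimpleGraph V} {f : Sym2 V → ℕ}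
    (hf : IsLocalAntimagic G f) : Set.InjOn (vertexSum G f) {v | IsPendant G v} := by
  intro a ha b hb hab
  obtain ⟨e, he, hae, hse⟩ := IsPendant.exists_vertexSum_eq f ha
  obtain ⟨e', he', hbe, hse'⟩ := IsPendant.exists_vertexSum_eq f hb
  obtain rfl : e = e' := hf.1.injOn he he' (by rw [← hse, ← hse', hab])
  by_contra hne
  obtain rfl := (Sym2.mem_and_mem_iff hne).1 ⟨hae, hbe⟩
  exact hf.2 he hab

/-- At a nonpendant vertex, the induced label exceeds the label of each incident edge. -/
lemma IsLocalAntimagic.lt_vertexSum [Fintype V] {G : SimpleGraph V} {f : Sym2 V → ℕ}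
    (hf : IsLocalAntimagic G f) {v : V} (hv : ¬ IsPendant G v) {e : Sym2 V}
    (he : e ∈ G.edgeSet) (hve : v ∈ e) : f e < vertexSum G f v := by
  have hmem : e ∈ G.incidenceFinset v := (G.mem_incidenceFinset v e).2 ⟨he, hve⟩
  have hcard : 1 < (G.incidenceFinset v).card := by
    have := Finset.card_pos.2 ⟨e, hmem⟩
    rw [IsPendant, ← G.card_incidenceFinset_eq_degree] at hv
    omega
  obtain ⟨e', hmem', hne⟩ := Finset.exists_mem_ne hcard e
  exact Finset.single_lt_sum hne hmem hmem'
    (hf.1.mapsTo ((G.mem_incidenceFinset v e').1 hmem').1).1 fun _ _ _ => Nat.zero_le _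

/-- Lemma: max label on a non-pendant edge forces at least `k + 2` colors.
If `G` is a connected graph with `q` edges and exactly `k` pendant vertices, `f` is a
local antimagic labeling of `G`, and the edge `e₀` carrying the largest label `q` is not a
pendant edge (i.e. no endpoint of `e₀` is a pendant vertex), then `c(f) ≥ k + 2`. -/
theorem max_label_nonpendant_colorCount [Fintype V] (G : SimpleGraph V)
    (hconn : G.Connected) (q k : ℕ)
    (hq : G.edgeFinset.card = q)
    (hk : pendantCount G = k)
    (f : Sym2 V → ℕ) (hf : IsLocalAntimagic G f)
    (e₀ : Sym2 V) (he₀ : e₀ ∈ G.edgeSet) (hfe₀ : f e₀ = q)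
    (hnp : ∀ v ∈ e₀, ¬ IsPendant G v) :
    k + 2 ≤ colorCount G f := by
  induction e₀ with | _ u v
  have hu := hf.lt_vertexSum (hnp u (Sym2.mem_mk_left u v)) he₀ (Sym2.mem_mk_left u v)
  have hv := hf.lt_vertexSum (hnp v (Sym2.mem_mk_right u v)) he₀ (Sym2.mem_mk_right u v)
  set P := Finset.univ.filter fun w => IsPendant G w with hP
  have hle : ∀ x ∈ P.image (vertexSum G f), x ≤ q := by
    intro x hx
    obtain ⟨w, hw, rfl⟩ := Finset.mem_image.1 hx
    obtain ⟨e, he, -, hwe⟩ :=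
      IsPendant.exists_vertexSum_eq (G := G) f (Finset.mem_filter.1 hw).2
    rw [hwe, ← hq]
    exact (hf.1.mapsTo he).2
  have hPcard : (P.image (vertexSum G f)).card = k := by
    rw [Finset.card_image_of_injOn, ← hk, pendantCount]
    exact hf.injOn_vertexSum.mono fun w hw => (Finset.mem_filter.1 hw).2
  have hdisj : Disjoint (P.image (vertexSum G f)) {vertexSum G f u, vertexSum G f v} := by
    rw [Finset.disjoint_left]
    intro x hx hx'
    have := hle x hx
    rcases Finset.mem_insert.1 hx' with rfl | hx'
    · omega
    · rw [Finset.mem_singleton] at hx'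
      omega
  rw [← hPcard, ← Finset.card_pair (hf.2 he₀), ← Finset.card_union_of_disjoint hdisj, colorCount]
  refine Finset.card_le_card (Finset.union_subset (Finset.image_subset_image
    (Finset.subset_univ _)) ?_)
  simp [Finset.insert_subset_iff]

end LocalAntimagic
end

section
/- Let G be a connected graph with exactly k pendant vertices. If G is not isomorphic to K₂, then χ_la(G) ≥ k + 1. -/
open Finset
open scoped Classical

namespace LocalAntimagic

variable {V : Type*}

/-- Labels from `B` can be distributed over `N` so that each `i` avoids the value `c i`, unless
all these values are one and the same element of `B`. -/
lemma exists_labels_avoiding {ι : Type*} (N : Finset ι) (B : Finset ℤ) (hcard : #N = #B)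
    (c : ι → ℤ) (hc : ¬ ∃ b ∈ B, ∀ i ∈ N, c i = b) :
    ∃ h : ι → ℤ, Set.InjOn h N ∧ N.image h = B ∧ ∀ i ∈ N, h i ≠ c i := by
  have step : ∀ n, ∀ h : ι → ℤ, Set.InjOn h N → N.image h = B →
      #(N.filter fun i => h i = c i) = n →
      ∃ h : ι → ℤ, Set.InjOn h N ∧ N.image h = B ∧ ∀ i ∈ N, h i ≠ c i := by
    intro n
    induction n using Nat.strong_induction_on with
    | _ n ih =>
      intro h hinj him hn
      by_cases hgood : ∀ i ∈ N, h i ≠ c i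
      · exact ⟨h, hinj, him, hgood⟩
      push Not at hgood
      obtain ⟨i, hi, hic⟩ := hgood
      have hb : h i ∈ B := him ▸ mem_image_of_mem h hi
      push Not at hc
      obtain ⟨j, hj, hjc⟩ := hc _ hb
      have hij : i ≠ j := by rintro rfl; exact hjc hic.symm
      have hmaps : ∀ a ∈ N, Equiv.swap i j a ∈ N := by
        intro a ha
        by_cases h1 : a = i
        · subst h1; simpa using hj
        by_cases h2 : a = j
        · subst h2; simpa using hi
        rwa [Equiv.swap_apply_of_ne_of_ne h1 h2]
      refine ih _ ?_ (h ∘ Equiv.swap i j) ?_ ?_ rfl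
      · rw [← hn]
        apply card_lt_card
        refine ⟨?_, ?_⟩
        · intro a ha
          simp only [mem_filter, Function.comp] at ha ⊢
          refine ⟨ha.1, ?_⟩
          by_cases h1 : a = i
          · subst h1; exact hic
          by_cases h2 : a = j
          · subst h2
            rw [Equiv.swap_apply_right] at ha
            exact absurd ha.2.symm hjc
          rw [Equiv.swap_apply_of_ne_of_ne h1 h2] at ha
          exact ha.2
        · intro hsub
          have := hsub (mem_filter.2 ⟨hi, hic⟩)
          simp only [mem_filter, Function.comp, Equiv.swap_apply_left] at this
          exact hij (hinj hi hj (hic.trans this.2.symm))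
      · intro a ha b hb hab
        exact (Equiv.swap i j).injective (hinj (hmaps a ha) (hmaps b hb) hab)
      · rw [← him]
        ext y
        simp only [mem_image, Function.comp]
        constructor
        · rintro ⟨a, ha, rfl⟩; exact ⟨_, hmaps a ha, rfl⟩
        · rintro ⟨a, ha, rfl⟩; exact ⟨_, hmaps a ha, by simp⟩
  obtain ⟨h, hh⟩ : ∃ h : ι → ℤ, Set.InjOn h N ∧ N.image h = B := by
    let e := Finset.equivOfCardEq hcard
    refine ⟨fun i => if hi : i ∈ N then (e ⟨i, hi⟩ : ℤ) else 0, ?_, ?_⟩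
    · intro a ha b hb hab
      have ha' : a ∈ N := ha
      have hb' : b ∈ N := hb
      simp only [ha', hb', dif_pos] at hab
      simpa using e.injective (Subtype.ext hab)
    · ext y
      simp only [mem_image]
      constructor
      · rintro ⟨a, ha, rfl⟩
        simp [ha]
      · intro hy
        refine ⟨e.symm ⟨y, hy⟩, (e.symm ⟨y, hy⟩).2, ?_⟩
        simp
  exact step _ h hh.1 hh.2 rfl

/-- A set of `k` labels such that exchanging one of its elements never produces the sum `d`. -/
lemma exists_subset_sum_exchange_ne (A : Finset ℤ) (k : ℕ) (hk : k ≤ #A) (d : ℤ) :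
    ∃ B ⊆ A, #B = k ∧ ∀ β ∈ A \ B, B.sum id + β - d ∉ B := by
  by_cases h : ∃ B ⊆ A, #B = k ∧ B.sum id = d
  · obtain ⟨B, hB, hBk, hs⟩ := h
    refine ⟨B, hB, hBk, fun β hβ => ?_⟩
    rw [hs, add_sub_cancel_left]
    exact (mem_sdiff.1 hβ).2
  · obtain ⟨B, hB, hBk⟩ := exists_subset_card_eq hk
    refine ⟨B, hB, hBk, fun β hβ hb => h ?_⟩
    rw [mem_sdiff] at hβ
    have hne : β ∉ B.erase (B.sum id + β - d) := fun h => hβ.2 (mem_of_mem_erase h)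
    refine ⟨insert β (B.erase (B.sum id + β - d)), ?_, ?_, ?_⟩
    · exact insert_subset hβ.1 ((erase_subset _ _).trans hB)
    · rw [card_insert_of_notMem hne, card_erase_of_mem hb, hBk]
      have : 0 < #B := card_pos.2 ⟨_, hb⟩
      omega
    · rw [sum_insert hne]
      have := sum_erase_add B id hb
      simp only [id] at this ⊢
      linarith

/-- The double star lemma on label sets, starting from a tight partition with the larger part
listed first. -/
lemma exists_partition_of_tight {B₀ C₀ : Finset ℤ} {β₀ : ℤ} (hdis : Disjoint B₀ C₀)
    (hB : β₀ ∉ B₀) (hC : β₀ ∉ C₀) (hcard : #C₀ ≤ #B₀) (hC0 : C₀.Nonempty) :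
    ∃ B C : Finset ℤ, ∃ β : ℤ, Disjoint B C ∧ β ∉ B ∧ β ∉ C ∧
      insert β (B ∪ C) = insert β₀ (B₀ ∪ C₀) ∧ #B = #B₀ ∧ #C = #C₀ ∧
      B.sum id + β - B₀.sum id ∉ B ∧ C.sum id + β - C₀.sum id ∉ C ∧
      B.sum id - C.sum id ≠ B₀.sum id - C₀.sum id := by
  set d := B₀.sum id with hd
  set d' := C₀.sum id with hd'
  have hB0 : B₀.Nonempty := card_pos.1 (hC0.card_pos.trans_le hcard)
  obtain ⟨b, hb⟩ := hB0
  obtain ⟨c, hc⟩ := hC0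
  have hbC : b ∉ C₀ := disjoint_left.1 hdis hb
  have hcB : c ∉ B₀ := disjoint_right.1 hdis hc
  have hbc : b ≠ c := fun h => hbC (h ▸ hc)
  obtain ⟨B₁, C₁, hdis₁, hun, hB₁, hC₁, hne, hkl⟩ : ∃ B₁ C₁ : Finset ℤ, Disjoint B₁ C₁ ∧
      B₁ ∪ C₁ = B₀ ∪ C₀ ∧ #B₁ = #B₀ ∧ #C₁ = #C₀ ∧ B₁.sum id ≠ d ∧
      (#B₀ = #C₀ → (#B₀ : ℤ) * (B₁.sum id - d) ≠ d - d') := by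
    by_cases h : #B₀ = #C₀ ∧ d ≠ d'
    · refine ⟨C₀, B₀, hdis.symm, union_comm _ _, h.1.symm, h.1, h.2.symm, fun _ h2 => ?_⟩
      rw [← hd'] at h2
      have : ((#B₀ : ℤ) + 1) * (d' - d) = 0 := by linarith
      rcases mul_eq_zero.1 this with h3 | h3
      · omega
      · exact h.2 (by linarith)
    · have h1 : c ∉ B₀.erase b := fun h => hcB (mem_of_mem_erase h)
      have h2 : b ∉ C₀.erase c := fun h => hbC (mem_of_mem_erase h)
      have hs := sum_erase_add B₀ id hb
      have hs1 : (insert c (B₀.erase b)).sum id = d + (c - b) := by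
        rw [sum_insert h1]; simp only [id] at hs ⊢; simp only [hd, id]; linarith
      refine ⟨insert c (B₀.erase b), insert b (C₀.erase c), ?_, ?_, ?_, ?_, ?_, ?_⟩
      · rw [disjoint_left] at hdis ⊢
        intro a ha
        simp only [mem_insert, mem_erase] at ha ⊢
        grind
      · ext a
        simp only [mem_union, mem_insert, mem_erase]
        grind
      · rw [card_insert_of_notMem h1, card_erase_add_one hb]
      · rw [card_insert_of_notMem h2, card_erase_add_one hc]
      · rw [hs1]; intro h; exact hbc (by linarith)
      · intro h3 h4
        have h5 : d = d' := by tauto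
        rw [hs1, h5] at h4
        have h6 : (#B₀ : ℤ) * (c - b) = 0 := by linarith
        rcases mul_eq_zero.1 h6 with h7 | h7
        · have : 0 < #B₀ := card_pos.2 ⟨b, hb⟩
          omega
        · exact hbc (by linarith)
  have hβ₀ : β₀ ∉ B₁ ∧ β₀ ∉ C₁ := by
    have : β₀ ∉ B₁ ∪ C₁ := by rw [hun, mem_union]; tauto
    simpa [mem_union, not_or] using this
  have htot : B₁.sum id + C₁.sum id = d + d' := by
    rw [← sum_union hdis₁, hun, sum_union hdis]
  set X := insert β₀ B₁ with hX
  set t := β₀ + (B₁.sum id - d) with ht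
  have hXs : X.sum id = t + d := by
    rw [hX, sum_insert hβ₀.1]; simp only [id, ht]; ring
  have hXC : Disjoint X C₁ := by
    rw [hX, disjoint_insert_left]; exact ⟨hβ₀.2, hdis₁⟩
  have hXcard : #X = #B₀ + 1 := by rw [hX, card_insert_of_notMem hβ₀.1, hB₁]
  suffices h : ∃ β ∈ X, t ∉ X.erase β ∧ β₀ - t + β ∉ C₁ ∧ β ≠ 2 * t - β₀ by
    obtain ⟨β, hβ, h1, h2, h3⟩ := h
    have hsum : (X.erase β).sum id = t + d - β := by
      have := sum_erase_add X id hβ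
      simp only [id] at this hXs ⊢; linarith
    refine ⟨X.erase β, C₁, β, hXC.mono_left (erase_subset _ _), notMem_erase _ _,
      disjoint_left.1 hXC hβ, ?_, ?_, hC₁, ?_, ?_, ?_⟩
    · rw [← insert_union, insert_erase hβ, hX, insert_union, hun]
    · rw [card_erase_of_mem hβ, hXcard]; rfl
    · rwa [hsum, show t + d - β + β - d = t by ring]
    · rwa [show C₁.sum id + β - d' = β₀ - t + β by rw [ht]; linarith]
    · rw [hsum]
      intro h4
      apply h3
      linarith
  by_cases htX : t ∈ X
  · refine ⟨t, htX, notMem_erase _ _, ?_, ?_⟩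
    · rw [sub_add_cancel]; exact hβ₀.2
    · intro h; apply hne; linarith
  · by_contra hcon
    push Not at hcon
    have hsub : X ⊆ (insert t C₁).image (fun z => z + (t - β₀)) := by
      intro β hβ
      rw [mem_image]
      by_cases h : β₀ - t + β ∈ C₁
      · exact ⟨_, mem_insert_of_mem h, by ring⟩
      · refine ⟨t, mem_insert_self _ _, ?_⟩
        rw [hcon β hβ (fun h => htX (mem_of_mem_erase h)) h]; ring
    have hc1 := card_le_card hsub
    have hc2 : #((insert t C₁).image (fun z => z + (t - β₀))) ≤ #(insert t C₁) := card_image_le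
    have hc3 := card_insert_le t C₁
    have hk : #B₀ = #C₀ := by omega
    have htC : t ∉ C₁ := by
      intro h
      rw [insert_eq_of_mem h] at hc1 hc2
      omega
    have heq := eq_of_subset_of_card_le hsub (by omega)
    have hs : X.sum id = ∑ z ∈ insert t C₁, (z + (t - β₀)) := by
      conv_lhs => rw [heq]
      rw [sum_image (fun a _ b _ h => by simpa using h)]
      rfl
    rw [hXs, sum_add_distrib, sum_insert htC, sum_const, card_insert_of_notMem htC, hC₁, ← hk]
      at hs
    apply hkl hk
    simp only [id, nsmul_eq_mul] at hs htot ht ⊢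
    push_cast at hs
    have : t - β₀ = ∑ x ∈ B₁, x - d := by linarith
    rw [this] at hs
    linarith

/-- Labels for a double star: `B` goes to the leaves of one centre, `C` to those of the other,
and `β` to the central edge. -/
lemma exists_double_star_partition (A : Finset ℤ) (k l : ℕ) (hk : 1 ≤ k) (hl : 1 ≤ l)
    (hA : #A = k + l + 1) (d d' e : ℤ) :
    ∃ B C : Finset ℤ, ∃ β : ℤ, Disjoint B C ∧ β ∉ B ∧ β ∉ C ∧
      insert β (B ∪ C) = A ∧ #B = k ∧ #C = l ∧
      B.sum id + β - d ∉ B ∧ C.sum id + β - d' ∉ C ∧ B.sum id - C.sum id ≠ e := by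
  have key : ∀ C ⊆ A, #C = l → (∀ β ∈ A \ C, C.sum id + β - d' ∉ C) →
      ((A \ C).sum id - d ∈ A \ C → d - C.sum id ≠ e) →
      ∃ B C : Finset ℤ, ∃ β : ℤ, Disjoint B C ∧ β ∉ B ∧ β ∉ C ∧
      insert β (B ∪ C) = A ∧ #B = k ∧ #C = l ∧
      B.sum id + β - d ∉ B ∧ C.sum id + β - d' ∉ C ∧ B.sum id - C.sum id ≠ e := by
    intro C hCA hCl hu he
    set X := A \ C with hX
    have hXc : #X = k + 1 := by rw [hX, card_sdiff_of_subset hCA]; omega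
    have hXC : Disjoint X C := sdiff_disjoint
    obtain ⟨β, hβ, h1, h2⟩ : ∃ β ∈ X, X.sum id - d ∉ X.erase β ∧
        X.sum id - β - C.sum id ≠ e := by
      by_cases ht : X.sum id - d ∈ X
      · exact ⟨_, ht, notMem_erase _ _, by rw [sub_sub_cancel]; exact he ht⟩
      · obtain ⟨x, hx, y, hy, hxy⟩ := one_lt_card.1 (show 1 < #X by omega)
        by_cases h : X.sum id - x - C.sum id = e
        · refine ⟨y, hy, fun h => ht (mem_of_mem_erase h), fun h' => hxy (by linarith)⟩
        · exact ⟨x, hx, fun h => ht (mem_of_mem_erase h), h⟩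
    have hsum := sum_erase_add X id hβ
    simp only [id] at hsum h1 h2
    refine ⟨X.erase β, C, β, hXC.mono_left (erase_subset _ _), notMem_erase _ _,
      disjoint_left.1 hXC hβ, ?_, ?_, hCl, ?_, hu β hβ, ?_⟩
    · rw [← insert_union, insert_erase hβ, hX, sdiff_union_of_subset hCA]
    · rw [card_erase_of_mem hβ, hXc]; rfl
    · simp only [id]; rwa [hsum]
    · simp only [id]; rwa [show ∑ x ∈ X.erase β, x = ∑ x ∈ X, x - β by linarith]
  by_cases hex : ∃ C ⊆ A, #C = l ∧ C.sum id = d'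
  · obtain ⟨C, hCA, hCl, hCs⟩ := hex
    by_cases hgood : (A \ C).sum id - d ∈ A \ C → d - C.sum id ≠ e
    · refine key C hCA hCl (fun β hβ => ?_) hgood
      rw [hCs, add_sub_cancel_left]; exact (mem_sdiff.1 hβ).2
    push Not at hgood
    obtain ⟨ht, he⟩ := hgood
    set X := A \ C with hX
    have hXc : #X = k + 1 := by rw [hX, card_sdiff_of_subset hCA]; omega
    set β₀ := X.sum id - d with hβ₀
    set B := X.erase β₀ with hB
    have hBc : #B = k := by rw [hB, card_erase_of_mem ht, hXc]; rfl
    have hBs : B.sum id = d := by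
      have := sum_erase_add X id ht
      simp only [id] at this hβ₀ ⊢
      linarith
    have hXC : Disjoint X C := sdiff_disjoint
    have hdis : Disjoint B C := hXC.mono_left (erase_subset _ _)
    have hins : insert β₀ (B ∪ C) = A := by
      rw [← insert_union, insert_erase ht, hX, sdiff_union_of_subset hCA]
    rcases le_total l k with h | h
    · obtain ⟨B', C', β, h1, h2, h3, h4, h5, h6, h7, h8, h9⟩ :=
        exists_partition_of_tight hdis (notMem_erase _ _) (disjoint_left.1 hXC ht) (by omega)
          (card_pos.1 (by omega))
      refine ⟨B', C', β, h1, h2, h3, h4.trans hins, by omega, by omega, ?_, ?_, ?_⟩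
      · rwa [hBs] at h7
      · rwa [hCs] at h8
      · rwa [hBs, he] at h9
    · obtain ⟨C', B', β, h1, h2, h3, h4, h5, h6, h7, h8, h9⟩ :=
        exists_partition_of_tight hdis.symm (disjoint_left.1 hXC ht) (notMem_erase _ _) (by omega)
          (card_pos.1 (by omega))
      refine ⟨B', C', β, h1.symm, h3, h2, ?_, by omega, by omega, ?_, ?_, ?_⟩
      · rw [union_comm, h4, union_comm, hins]
      · rwa [hBs] at h8
      · rwa [hCs] at h7
      · intro h10
        apply h9
        linarith
  · have hu : ∀ C ⊆ A, #C = l → ∀ β ∈ A \ C, C.sum id + β - d' ∉ C := by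
      intro C hCA hCl β hβ hb
      rw [mem_sdiff] at hβ
      have hne : β ∉ C.erase (C.sum id + β - d') := fun h => hβ.2 (mem_of_mem_erase h)
      refine hex ⟨insert β (C.erase (C.sum id + β - d')),
        insert_subset hβ.1 ((erase_subset _ _).trans hCA), ?_, ?_⟩
      · rw [card_insert_of_notMem hne, card_erase_add_one hb, hCl]
      · rw [sum_insert hne]
        have := sum_erase_add C id hb
        simp only [id] at this ⊢
        linarith
    obtain ⟨C, hCA, hCl⟩ := exists_subset_card_eq (show l ≤ #A by omega)
    by_cases hCs : d - C.sum id = e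
    · obtain ⟨c, hc⟩ := card_pos.1 (show 0 < #C by omega)
      obtain ⟨x, hx⟩ := card_pos.1 (show 0 < #(A \ C) by rw [card_sdiff_of_subset hCA]; omega)
      rw [mem_sdiff] at hx
      have hne : x ∉ C.erase c := fun h => hx.2 (mem_of_mem_erase h)
      have h1 : insert x (C.erase c) ⊆ A := insert_subset hx.1 ((erase_subset _ _).trans hCA)
      have h2 : #(insert x (C.erase c)) = l := by
        rw [card_insert_of_notMem hne, card_erase_add_one hc, hCl]
      refine key _ h1 h2 (hu _ h1 h2) (fun _ h => ?_)
      rw [sum_insert hne] at h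
      have := sum_erase_add C id hc
      simp only [id] at this h hCs
      exact hx.2 ((show x = c by linarith) ▸ hc)
    · exact key C hCA hCl (hu C hCA hCl) (fun _ => hCs)

/-- The `r` largest elements of a finite set. -/
lemma exists_top_subset (A : Finset ℤ) (r : ℕ) (hr : r ≤ #A) :
    ∃ T ⊆ A, #T = r ∧ ∀ a ∈ T, ∀ b ∈ A, b ∉ T → b < a := by
  induction r with
  | zero => exact ⟨∅, by simp⟩
  | succ r ih =>
    obtain ⟨T, hT, hTr, htop⟩ := ih (by omega)
    have hne : (A \ T).Nonempty := card_pos.1 (by rw [card_sdiff_of_subset hT]; omega)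
    obtain ⟨m, hm, hmax⟩ := exists_max_image (A \ T) id hne
    rw [mem_sdiff] at hm
    refine ⟨insert m T, insert_subset hm.1 hT, by rw [card_insert_of_notMem hm.2, hTr], ?_⟩
    intro a ha b hb hbT
    rw [mem_insert, not_or] at hbT
    rcases mem_insert.1 ha with rfl | ha
    · exact lt_of_le_of_ne (hmax b (mem_sdiff.2 ⟨hb, hbT.2⟩)) hbT.1
    · exact htop a ha b hb hbT.2

lemma sum_lt_sum_top {A T S : Finset ℤ} (htop : ∀ a ∈ T, ∀ b ∈ A, b ∉ T → b < a)
    (hS : S ⊆ A) (hcard : #S = #T) (hne : S ≠ T) : S.sum id < T.sum id := by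
  have h1 := card_sdiff_add_card_inter S T
  have h2 := card_sdiff_add_card_inter T S
  rw [inter_comm] at h2
  have hc : #(S \ T) = #(T \ S) := by omega
  have hST : (S \ T).Nonempty := by
    rw [sdiff_nonempty]
    exact fun h => hne (eq_of_subset_of_card_le h hcard.ge)
  obtain ⟨m, hm, hmax⟩ := exists_max_image (S \ T) id hST
  have h3 : (S \ T).sum id ≤ #(S \ T) • m := sum_le_card_nsmul _ _ _ hmax
  have h4 : #(T \ S) • (m + 1) ≤ (T \ S).sum id := by
    apply card_nsmul_le_sum
    intro a ha
    rw [mem_sdiff] at ha hm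
    exact htop a ha.1 m (hS hm.1) hm.2
  have h5 := sum_inter_add_sum_sdiff S T id
  have h6 := sum_inter_add_sum_sdiff T S id
  rw [inter_comm] at h6
  have h7 : 0 < #(S \ T) := hST.card_pos
  rw [hc] at h3 h7
  simp only [nsmul_eq_mul] at h3 h4
  have h8 : (0 : ℤ) < #(T \ S) := by exact_mod_cast h7
  linarith

lemma top_subset_top {A T T' : Finset ℤ} (htop : ∀ a ∈ T, ∀ b ∈ A, b ∉ T → b < a)
    (htop' : ∀ a ∈ T', ∀ b ∈ A, b ∉ T' → b < a) (hT : T ⊆ A) (hT' : T' ⊆ A)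
    (hcard : #T ≤ #T') : T ⊆ T' := by
  intro a ha
  by_contra ha'
  have hsub : T' ⊆ T.erase a := by
    intro b hb
    have hab := htop' b hb a (hT ha) ha'
    refine mem_erase.2 ⟨hab.ne', ?_⟩
    by_contra hbT
    exact absurd (htop a ha b (hT' hb) hbT) hab.not_gt
  have := card_le_card hsub
  have := card_erase_add_one ha
  omega

/-- The edges from `v` to the vertices of `L`. -/
noncomputable def starEdges (v : V) (L : Finset V) : Finset (Sym2 V) :=
  L.image fun w => s(v, w)

/-- The edge labeling that gives `s(v, w)` the label `h w`. -/
noncomputable def starLabel (v : V) (h : V → ℤ) : Sym2 V → ℤ :=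
  Sym2.lift ⟨fun a b => if a = v then h b else if b = v then h a else 0, by
    intro a b
    by_cases ha : a = v <;> by_cases hb : b = v <;> simp [ha, hb]⟩

lemma mk_mem_starEdges {v a b : V} {L : Finset V} :
    s(a, b) ∈ starEdges v L ↔ (a = v ∧ b ∈ L) ∨ (b = v ∧ a ∈ L) := by
  simp only [starEdges, mem_image, Sym2.eq_iff]
  grind

lemma starLabel_mk (v w : V) (h : V → ℤ) : starLabel v h s(v, w) = h w := by
  simp [starLabel]

lemma card_starEdges (v : V) (L : Finset V) : #(starEdges v L) = #L := by
  apply card_image_of_injective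
  intro a b h
  rcases Sym2.eq_iff.1 h with h | h
  · exact h.2
  · exact h.2.trans h.1

section WeightedLabelings

variable [Fintype V]

/-- The neighbors of `v` in the graph with edge set `E`. -/
noncomputable def nbrs (E : Finset (Sym2 V)) (v : V) : Finset V :=
  univ.filter fun w => s(v, w) ∈ E

/-- The vertex sum of `v` shifted by the initial weight `p v`. -/
noncomputable def wsum (E : Finset (Sym2 V)) (p : V → ℤ) (f : Sym2 V → ℤ) (v : V) : ℤ :=
  p v + ∑ w ∈ nbrs E v, f s(v, w)

/-- `f` labels `E` bijectively by `A`, and weighted vertex sums distinguish adjacent vertices. -/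
def IsWeightedLabeling (E : Finset (Sym2 V)) (p : V → ℤ) (A : Finset ℤ) (f : Sym2 V → ℤ) : Prop :=
  Set.InjOn f E ∧ E.image f = A ∧ ∀ u v, s(u, v) ∈ E → wsum E p f u ≠ wsum E p f v

/-- `z` is the center of a star component whose weights may obstruct a weighted labeling. -/
def IsUnsafe (E : Finset (Sym2 V)) (p : V → ℤ) (z : V) : Prop :=
  (nbrs E z).Nonempty ∧ (∀ w ∈ nbrs E z, nbrs E w = {z}) ∧
    ∃ q, (∀ w ∈ nbrs E z, p w = q) ∧ (if #(nbrs E z) = 1 then p z = q else p z < q)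

@[simp] lemma mem_nbrs {E : Finset (Sym2 V)} {v w : V} : w ∈ nbrs E v ↔ s(v, w) ∈ E := by
  simp [nbrs]

lemma mem_nbrs_comm {E : Finset (Sym2 V)} {v w : V} : w ∈ nbrs E v ↔ v ∈ nbrs E w := by
  rw [mem_nbrs, mem_nbrs, Sym2.eq_swap]

lemma starEdges_subset {E : Finset (Sym2 V)} {v : V} {L : Finset V} (hL : L ⊆ nbrs E v) :
    starEdges v L ⊆ E := by
  intro e he
  obtain ⟨w, hw, rfl⟩ := mem_image.1 he
  exact mem_nbrs.1 (hL hw)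

lemma mem_nbrs_sdiff {E : Finset (Sym2 V)} {v a b : V} {L : Finset V} :
    b ∈ nbrs (E \ starEdges v L) a ↔ b ∈ nbrs E a ∧ ¬ ((a = v ∧ b ∈ L) ∨ (b = v ∧ a ∈ L)) := by
  rw [mem_nbrs, mem_sdiff, mk_mem_starEdges, mem_nbrs]

lemma not_isUnsafe_of_agree {E E' : Finset (Sym2 V)} {p p' : V → ℤ} {z : V}
    (h : ¬ IsUnsafe E p z) (hE : ∀ y, y = z ∨ y ∈ nbrs E' z → nbrs E' y = nbrs E y)
    (hp : ∀ y, y = z ∨ y ∈ nbrs E' z → p' y = p y) : ¬ IsUnsafe E' p' z := by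
  rintro ⟨h1, h2, q, h3, h4⟩
  have hz := hE z (Or.inl rfl)
  refine h ⟨hz ▸ h1, fun w hw => ?_, q, fun w hw => ?_, ?_⟩
  · rw [← hz] at hw
    rw [← hE w (Or.inr hw)]; exact h2 w hw
  · rw [← hz] at hw
    rw [← hp w (Or.inr hw)]; exact h3 w hw
  · rw [← hz, ← hp z (Or.inl rfl)]; exact h4

/-- A labeling of a star at `v` and a labeling of the other edges combine. -/
lemma exists_merged_labeling {E : Finset (Sym2 V)} (hE : ∀ v, s(v, v) ∉ E) (p : V → ℤ) {v : V}
    {L : Finset V} (hL : L ⊆ nbrs E v) {A B : Finset ℤ} (hB : B ⊆ A) {h : V → ℤ}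
    (hinj : Set.InjOn h L) (him : L.image h = B) {f' : Sym2 V → ℤ}
    (hinj' : Set.InjOn f' (E \ starEdges v L : Finset (Sym2 V)))
    (him' : (E \ starEdges v L).image f' = A \ B) :
    ∃ f : Sym2 V → ℤ, Set.InjOn f E ∧ E.image f = A ∧
      (∀ z, wsum E p f z = wsum (E \ starEdges v L)
        (fun y => p y + (if y = v then B.sum id else 0) + (if y ∈ L then h y else 0)) f' z) ∧
      ∀ w ∈ L, f s(v, w) = h w := by
  have hvL : v ∉ L := fun h => hE v (mem_nbrs.1 (hL h))
  set F := starEdges v L with hF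
  have hFE : F ⊆ E := starEdges_subset hL
  set f : Sym2 V → ℤ := fun e => if e ∈ F then starLabel v h e else f' e with hf
  have hfF : ∀ w ∈ L, f s(v, w) = h w := by
    intro w hw
    have : s(v, w) ∈ F := mk_mem_starEdges.2 (Or.inl ⟨rfl, hw⟩)
    simp only [hf, this, if_true, starLabel_mk]
  have hfF' : ∀ e ∈ F, ∃ w ∈ L, e = s(v, w) ∧ f e = h w := by
    intro e he
    obtain ⟨w, hw, rfl⟩ := mem_image.1 he
    exact ⟨w, hw, rfl, hfF w hw⟩
  have hfE : ∀ e ∉ F, f e = f' e := fun e he => by simp only [hf, he, if_false]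
  have hmemB : ∀ e ∈ F, f e ∈ B := by
    intro e he
    obtain ⟨w, hw, -, h2⟩ := hfF' e he
    rw [h2, ← him]; exact mem_image_of_mem _ hw
  have hmemA : ∀ e ∈ E, e ∉ F → f e ∈ A \ B := by
    intro e he heF
    rw [hfE e heF, ← him']; exact mem_image_of_mem _ (mem_sdiff.2 ⟨he, heF⟩)
  refine ⟨f, ?_, ?_, ?_, hfF⟩
  · intro a ha b hb hab
    by_cases haF : a ∈ F <;> by_cases hbF : b ∈ F
    · obtain ⟨w, hw, rfl, h2⟩ := hfF' a haF
      obtain ⟨w', hw', rfl, h2'⟩ := hfF' b hbF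
      rw [h2, h2'] at hab
      rw [hinj hw hw' hab]
    · exact absurd (hab ▸ hmemB a haF) (mem_sdiff.1 (hmemA b hb hbF)).2
    · exact absurd (hab ▸ hmemB b hbF) (mem_sdiff.1 (hmemA a ha haF)).2
    · rw [hfE a haF, hfE b hbF] at hab
      exact hinj' (mem_coe.2 (mem_sdiff.2 ⟨ha, haF⟩)) (mem_coe.2 (mem_sdiff.2 ⟨hb, hbF⟩)) hab
  · ext y
    rw [mem_image]
    constructor
    · rintro ⟨e, he, rfl⟩
      by_cases heF : e ∈ F
      · exact hB (hmemB e heF)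
      · exact (mem_sdiff.1 (hmemA e he heF)).1
    · intro hy
      by_cases hyB : y ∈ B
      · rw [← him] at hyB
        obtain ⟨w, hw, rfl⟩ := mem_image.1 hyB
        exact ⟨s(v, w), mem_nbrs.1 (hL hw), hfF w hw⟩
      · have : y ∈ A \ B := mem_sdiff.2 ⟨hy, hyB⟩
        rw [← him'] at this
        obtain ⟨e, he, rfl⟩ := mem_image.1 this
        exact ⟨e, (mem_sdiff.1 he).1, hfE e (mem_sdiff.1 he).2⟩
  · intro z
    have hsplit : ∑ w ∈ nbrs E z, f s(z, w) =
        ∑ w ∈ (nbrs E z).filter (fun w => s(z, w) ∈ F), f s(z, w) +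
          ∑ w ∈ nbrs (E \ F) z, f' s(z, w) := by
      rw [← sum_filter_add_sum_filter_not (nbrs E z) (fun w => s(z, w) ∈ F)]
      congr 1
      apply sum_congr
      · ext w; simp [mem_sdiff]
      · intro w hw
        exact hfE _ (mem_sdiff.1 (mem_nbrs.1 hw)).2
    have hfirst : ∑ w ∈ (nbrs E z).filter (fun w => s(z, w) ∈ F), f s(z, w) =
        (if z = v then B.sum id else 0) + (if z ∈ L then h z else 0) := by
      by_cases hzv : z = v
      · subst hzv
        have : (nbrs E z).filter (fun w => s(z, w) ∈ F) = L := by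
          ext w
          rw [mem_filter, hF, mk_mem_starEdges]
          constructor
          · rintro ⟨-, h | h⟩
            · exact h.2
            · exact absurd h.2 hvL
          · exact fun h => ⟨hL h, Or.inl ⟨rfl, h⟩⟩
        rw [this, if_pos rfl, if_neg hvL, add_zero, ← him, sum_image hinj]
        exact sum_congr rfl hfF
      · by_cases hzL : z ∈ L
        · have : (nbrs E z).filter (fun w => s(z, w) ∈ F) = {v} := by
            ext w
            rw [mem_filter, hF, mk_mem_starEdges, mem_singleton]
            constructor
            · rintro ⟨-, h | h⟩
              · exact absurd h.1 hzv
              · exact h.1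
            · rintro rfl
              exact ⟨mem_nbrs_comm.1 (hL hzL), Or.inr ⟨rfl, hzL⟩⟩
          rw [this, sum_singleton, if_neg hzv, if_pos hzL, zero_add, Sym2.eq_swap, hfF z hzL]
        · have : (nbrs E z).filter (fun w => s(z, w) ∈ F) = ∅ := by
            apply filter_false_of_mem
            intro w _
            rw [hF, mk_mem_starEdges]
            tauto
          rw [this, sum_empty, if_neg hzv, if_neg hzL, zero_add]
    simp only [wsum]
    rw [hsplit, hfirst]
    ring

/-- Leaves attached to `v` can be labeled by `B` once the rest of the graph is labeled. -/
lemma exists_labeling_of_remove_leaves {E : Finset (Sym2 V)} (hE : ∀ v, s(v, v) ∉ E) {p : V → ℤ}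
    {v : V} {L : Finset V} (hL : ∀ w ∈ L, nbrs E w = {v}) {A B : Finset ℤ} (hB : B ⊆ A)
    (hcard : #B = #L) {f' : Sym2 V → ℤ}
    (hf' : IsWeightedLabeling (E \ starEdges v L) (Function.update p v (p v + B.sum id)) (A \ B) f')
    (hc : ∀ q, (∀ w ∈ L, p w = q) →
      wsum (E \ starEdges v L) (Function.update p v (p v + B.sum id)) f' v - q ∉ B) :
    ∃ f, IsWeightedLabeling E p A f ∧
      (∀ z ∉ L, wsum E p f z =
        wsum (E \ starEdges v L) (Function.update p v (p v + B.sum id)) f' z) ∧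
      ∀ w ∈ L, wsum E p f w - p w ∈ B := by
  set p' := Function.update p v (p v + B.sum id) with hp'
  set s := wsum (E \ starEdges v L) p' f' v with hs
  have hLn : L ⊆ nbrs E v := fun w hw => by
    rw [mem_nbrs_comm, hL w hw]; exact mem_singleton_self _
  have hvL : v ∉ L := fun h => hE v (mem_nbrs.1 (hLn h))
  obtain ⟨h, hinj, him, hne⟩ := exists_labels_avoiding L B hcard.symm (fun w => s - p w) (by
    rintro ⟨b, hb, hall⟩
    refine hc (s - b) (fun w hw => ?_) (by rwa [sub_sub_cancel])
    have := hall w hw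
    linarith)
  obtain ⟨f, hf1, hf2, hf3, -⟩ := exists_merged_labeling hE p hLn hB hinj him hf'.1 hf'.2.1
  have hz : ∀ z ∉ L, wsum E p f z = wsum (E \ starEdges v L) p' f' z := by
    intro z hzL
    rw [hf3]
    simp only [wsum, if_neg hzL, hp', Function.update_apply]
    by_cases hzv : z = v
    · subst hzv; simp
    · simp [hzv]
  have hw : ∀ w ∈ L, wsum E p f w = p w + h w := by
    intro w hw
    have hwv : w ≠ v := fun h => hvL (h ▸ hw)
    have : nbrs (E \ starEdges v L) w = ∅ := by
      ext y
      rw [mem_nbrs_sdiff, hL w hw, mem_singleton]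
      simp only [notMem_empty, iff_false]
      tauto
    rw [hf3]
    simp only [wsum, this, sum_empty, if_neg hwv, if_pos hw]
    ring
  have hconf : ∀ a b, s(a, b) ∈ E → a ∈ L → wsum E p f a ≠ wsum E p f b := by
    intro a b hab ha
    have hb : b = v := by rw [← mem_singleton, ← hL a ha]; exact mem_nbrs.2 hab
    rw [hb, hw a ha, hz v hvL, ← hs]
    intro heq
    apply hne a ha
    show h a = s - p a
    linarith
  refine ⟨f, ⟨hf1, hf2, fun a b hab => ?_⟩, hz, fun w hwL => ?_⟩
  · by_cases ha : a ∈ L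
    · exact hconf a b hab ha
    by_cases hb : b ∈ L
    · exact (hconf b a (Sym2.eq_swap ▸ hab) hb).symm
    rw [hz a ha, hz b hb]
    apply hf'.2.2
    rw [mem_sdiff, mk_mem_starEdges]
    tauto
  · rw [hw w hwL, add_sub_cancel_left, ← him]
    exact mem_image_of_mem _ hwL

lemma card_sdiff_starEdges {E : Finset (Sym2 V)} {v : V} {L : Finset V} (hL : L ⊆ nbrs E v) :
    #(E \ starEdges v L) + #L = #E := by
  rw [← card_starEdges v L]
  exact card_sdiff_add_card_eq_card (starEdges_subset hL)

lemma not_isUnsafe_of_remove_component {E E' : Finset (Sym2 V)} {p p' : V → ℤ} (D : V → Prop)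
    (hD : ∀ y, D y → nbrs E' y = ∅) (hD' : ∀ y, ¬ D y → nbrs E' y = nbrs E y ∧ p' y = p y)
    (h : ∀ z, ¬ IsUnsafe E p z) (z : V) : ¬ IsUnsafe E' p' z := by
  intro hz
  have key : ∀ y, y = z ∨ y ∈ nbrs E' z → ¬ D y := by
    rintro y (rfl | hy) hDy
    · exact hz.1.ne_empty (hD _ hDy)
    · have := mem_nbrs_comm.1 hy
      rw [hD y hDy] at this
      exact notMem_empty _ this
  exact not_isUnsafe_of_agree (h z) (fun y hy => (hD' y (key y hy)).1)
    (fun y hy => (hD' y (key y hy)).2) hz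

/-- Safe weighted graphs with fewer than `n` edges have weighted labelings. -/
def LabelableBelow (V : Type*) [Fintype V] (n : ℕ) : Prop :=
  ∀ (E : Finset (Sym2 V)) (p : V → ℤ) (A : Finset ℤ), #E < n → (∀ v, s(v, v) ∉ E) → #A = #E →
    (∀ a ∈ A, 0 < a) → (∀ z, ¬ IsUnsafe E p z) → ∃ f, IsWeightedLabeling E p A f

lemma exists_labeling_of_star_component {E : Finset (Sym2 V)} {p : V → ℤ} {A : Finset ℤ}
    (ih : LabelableBelow V #E) (hE : ∀ v, s(v, v) ∉ E) (hA : #A = #E) (hpos : ∀ a ∈ A, 0 < a)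
    (hsafe : ∀ z, ¬ IsUnsafe E p z) {v : V} (hv : (nbrs E v).Nonempty)
    (hleaf : ∀ w ∈ nbrs E v, nbrs E w = {v}) : ∃ f, IsWeightedLabeling E p A f := by
  have hcard := card_sdiff_starEdges (subset_refl (nbrs E v))
  have hvpos := hv.card_pos
  obtain ⟨B, hB, hBc⟩ := exists_subset_card_eq (show #(nbrs E v) ≤ #A by omega)
  have hvv : v ∉ nbrs E v := fun h => hE v (mem_nbrs.1 h)
  have hnv : nbrs (E \ starEdges v (nbrs E v)) v = ∅ := by
    ext y; rw [mem_nbrs_sdiff]; simp only [notMem_empty, iff_false]; tauto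
  obtain ⟨f', hf'⟩ := ih (E \ starEdges v (nbrs E v)) (Function.update p v (p v + B.sum id))
    (A \ B) (by omega) (fun w hw => hE w (mem_sdiff.1 hw).1)
    (by rw [card_sdiff_of_subset hB]; omega) (fun a ha => hpos a (mem_sdiff.1 ha).1)
    (not_isUnsafe_of_remove_component (fun y => y = v ∨ y ∈ nbrs E v) (by
      rintro y (rfl | hy)
      · exact hnv
      · ext w
        rw [mem_nbrs_sdiff, hleaf y hy, mem_singleton]
        simp only [notMem_empty, iff_false]
        tauto) (by
      intro y hy
      push Not at hy
      refine ⟨?_, Function.update_of_ne hy.1 _ _⟩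
      ext w
      rw [mem_nbrs_sdiff]
      tauto) hsafe)
  obtain ⟨f, hf, -⟩ := exists_labeling_of_remove_leaves hE hleaf hB hBc hf' (by
    intro q hq hmem
    rw [wsum, hnv, sum_empty, add_zero, Function.update_self] at hmem
    refine hsafe v ⟨hv, hleaf, q, hq, ?_⟩
    split_ifs with h1
    · rw [h1] at hBc
      obtain ⟨b, rfl⟩ := card_eq_one.1 hBc
      simp only [sum_singleton, id, mem_singleton] at hmem
      linarith
    · have hs := sum_erase_add B id hmem
      have : 0 < (B.erase (p v + B.sum id - q)).sum id := by
        apply sum_pos (fun i hi => hpos i (hB (mem_of_mem_erase hi)))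
        apply card_pos.1
        rw [card_erase_of_mem hmem]
        omega
      simp only [id] at hs this
      linarith)
  exact ⟨f, hf⟩

lemma exists_labeling_of_double_star_component {E : Finset (Sym2 V)} {p : V → ℤ} {A : Finset ℤ}
    (ih : LabelableBelow V #E) (hE : ∀ v, s(v, v) ∉ E) (hA : #A = #E) (hpos : ∀ a ∈ A, 0 < a)
    (hsafe : ∀ z, ¬ IsUnsafe E p z) {u v : V} (huv : u ∈ nbrs E v)
    (hv : ((nbrs E v).erase u).Nonempty) (hu : ((nbrs E u).erase v).Nonempty)
    (hvl : ∀ w ∈ (nbrs E v).erase u, nbrs E w = {v})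
    (hul : ∀ w ∈ (nbrs E u).erase v, nbrs E w = {u}) : ∃ f, IsWeightedLabeling E p A f := by
  have hne : u ≠ v := by rintro rfl; exact hE u (mem_nbrs.1 huv)
  have hvu : v ∈ nbrs E u := mem_nbrs_comm.1 huv
  set Lv := (nbrs E v).erase u with hLv
  set Lu := (nbrs E u).erase v with hLu
  have huLu : u ∉ Lu := fun h => hE u (mem_nbrs.1 (mem_of_mem_erase h))
  have hvLv : v ∉ Lv := fun h => hE v (mem_nbrs.1 (mem_of_mem_erase h))
  have huLv : u ∉ Lv := notMem_erase _ _
  have hvLu : v ∉ Lu := notMem_erase _ _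
  have hvmem : ∀ w, w ∈ nbrs E v ↔ w = u ∨ w ∈ Lv := by
    intro w; rw [hLv, mem_erase]; by_cases h : w = u <;> simp [h, mem_nbrs.1 huv]
  have humem : ∀ w, w ∈ nbrs E u ↔ w = v ∨ w ∈ Lu := by
    intro w; rw [hLu, mem_erase]; by_cases h : w = v <;> simp [h, mem_nbrs.1 hvu]
  have hdisL : ∀ w ∈ Lv, w ∉ Lu := by
    intro w h1 h2
    have h3 := hvl w h1
    rw [hul w h2, singleton_inj] at h3
    exact hne h3
  set E1 := E \ starEdges u Lu with hE1
  set E2 := E1 \ starEdges v Lv with hE2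
  set E3 := E2 \ starEdges v {u} with hE3
  have m1 : ∀ a b, b ∈ nbrs E1 a ↔ b ∈ nbrs E a ∧ ¬ ((a = u ∧ b ∈ Lu) ∨ (b = u ∧ a ∈ Lu)) :=
    fun a b => mem_nbrs_sdiff
  have m2 : ∀ a b, b ∈ nbrs E2 a ↔ b ∈ nbrs E1 a ∧ ¬ ((a = v ∧ b ∈ Lv) ∨ (b = v ∧ a ∈ Lv)) :=
    fun a b => mem_nbrs_sdiff
  have m3 : ∀ a b, b ∈ nbrs E3 a ↔ b ∈ nbrs E2 a ∧ ¬ ((a = v ∧ b = u) ∨ (b = v ∧ a = u)) := by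
    intro a b; rw [hE3, mem_nbrs_sdiff, mem_singleton, mem_singleton]
  have hL1 : Lv ⊆ nbrs E1 v := by
    intro w hw
    rw [m1, hvmem]
    refine ⟨Or.inr hw, ?_⟩
    rintro (h | h)
    · exact hne h.1.symm
    · exact hvLu h.2
  have hL2 : {u} ⊆ nbrs E2 v := by
    rw [singleton_subset_iff, m2, m1]
    exact ⟨⟨huv, by tauto⟩, by tauto⟩
  have hLvl1 : ∀ w ∈ Lv, nbrs E1 w = {v} := by
    intro w hw
    ext y
    rw [m1, hvl w hw, mem_singleton]
    have := hdisL w hw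
    constructor
    · exact fun h => h.1
    · rintro rfl
      refine ⟨rfl, ?_⟩
      rintro (h | h)
      · exact huLv (h.1 ▸ hw)
      · exact this h.2
  have hLul2 : ∀ w ∈ ({u} : Finset V), nbrs E2 w = {v} := by
    intro w hw
    rw [mem_singleton] at hw
    subst hw
    ext y
    rw [m2, m1, humem, mem_singleton]
    constructor
    · rintro ⟨⟨h1 | h1, h2⟩, h3⟩
      · exact h1
      · tauto
    · rintro rfl
      tauto
  have c1 := card_sdiff_starEdges (erase_subset v (nbrs E u))
  have c2 := card_sdiff_starEdges hL1
  have c3 := card_sdiff_starEdges hL2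
  rw [← hLu, ← hE1] at c1
  rw [← hE2] at c2
  rw [← hE3, card_singleton] at c3
  obtain ⟨A', hA', hA'c⟩ := exists_subset_card_eq (show #Lv + #Lu + 1 ≤ #A by omega)
  obtain ⟨w0, hw0⟩ := id hv
  obtain ⟨z0, hz0⟩ := id hu
  obtain ⟨B, C, β, hBC, hβB, hβC, hins, hBc, hCc, hgB, hgC, hgu⟩ :=
    exists_double_star_partition A' #Lv #Lu hv.card_pos hu.card_pos hA'c (p w0 - p v)
      (p z0 - p u) (p u - p v)
  have hCA : C ⊆ A := fun a ha => hA' (hins ▸ by simp [ha])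
  have hBA : B ⊆ A \ C := fun a ha =>
    mem_sdiff.2 ⟨hA' (hins ▸ by simp [ha]), disjoint_left.1 hBC ha⟩
  have hβA : {β} ⊆ (A \ C) \ B := by
    rw [singleton_subset_iff, mem_sdiff, mem_sdiff]
    exact ⟨⟨hA' (hins ▸ by simp), hβC⟩, hβB⟩
  set p1 := Function.update p u (p u + C.sum id) with hp1
  set p2 := Function.update p1 v (p1 v + B.sum id) with hp2
  set p3 := Function.update p2 v (p2 v + ({β} : Finset ℤ).sum id) with hp3
  have hp1v : p1 v = p v := Function.update_of_ne hne.symm _ _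
  have hp2v : p2 v = p v + B.sum id := by rw [hp2, Function.update_self, hp1v]
  have hp2u : p2 u = p u + C.sum id := by
    rw [hp2, Function.update_of_ne hne, hp1, Function.update_self]
  have hp3v : p3 v = p v + B.sum id + β := by
    rw [hp3, Function.update_self, hp2v, sum_singleton, id]
  have hn3v : nbrs E3 v = ∅ := by
    refine eq_empty_of_forall_notMem fun y hy => ?_
    rw [m3, m2, m1, hvmem] at hy
    obtain ⟨⟨⟨h1 | h1, -⟩, h3⟩, h4⟩ := hy
    · exact h4 (Or.inl ⟨rfl, h1⟩)
    · exact h3 (Or.inl ⟨rfl, h1⟩)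
  obtain ⟨f3, hf3⟩ := ih E3 p3 (((A \ C) \ B) \ {β}) (by omega)
    (fun w hw => hE w (mem_sdiff.1 (mem_sdiff.1 (mem_sdiff.1 hw).1).1).1)
    (by rw [card_sdiff_of_subset hβA, card_sdiff_of_subset hBA, card_sdiff_of_subset hCA,
          card_singleton]; omega)
    (fun a ha => hpos a (mem_sdiff.1 (mem_sdiff.1 (mem_sdiff.1 ha).1).1).1)
    (not_isUnsafe_of_remove_component (fun y => y = u ∨ y = v ∨ y ∈ Lv ∨ y ∈ Lu) (by
      rintro y (rfl | rfl | hy | hy)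
      · refine eq_empty_of_forall_notMem fun w hw => ?_
        rw [m3, m2, m1, humem] at hw
        obtain ⟨⟨⟨h1 | h1, h2⟩, -⟩, h4⟩ := hw
        · exact h4 (Or.inr ⟨h1, rfl⟩)
        · exact h2 (Or.inl ⟨rfl, h1⟩)
      · exact hn3v
      · refine eq_empty_of_forall_notMem fun w hw => ?_
        rw [m3, m2, m1, hvl y hy, mem_singleton] at hw
        exact hw.1.2 (Or.inr ⟨hw.1.1.1, hy⟩)
      · refine eq_empty_of_forall_notMem fun w hw => ?_
        rw [m3, m2, m1, hul y hy, mem_singleton] at hw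
        exact hw.1.1.2 (Or.inr ⟨hw.1.1.1, hy⟩)) (by
      intro y hy
      push Not at hy
      refine ⟨?_, ?_⟩
      · ext w
        rw [m3, m2, m1]
        refine ⟨fun h => h.1.1.1, fun h => ⟨⟨⟨h, ?_⟩, ?_⟩, ?_⟩⟩
        · exact not_or.2 ⟨fun h => hy.1 h.1, fun h => hy.2.2.2 h.2⟩
        · exact not_or.2 ⟨fun h => hy.2.1 h.1, fun h => hy.2.2.1 h.2⟩
        · exact not_or.2 ⟨fun h => hy.2.1 h.1, fun h => hy.1 h.2⟩
      · rw [hp3, Function.update_of_ne hy.2.1, hp2, Function.update_of_ne hy.2.1, hp1,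
          Function.update_of_ne hy.1]) hsafe)
  have hE1' : ∀ w, s(w, w) ∉ E1 := fun w hw => hE w (mem_sdiff.1 hw).1
  have hE2' : ∀ w, s(w, w) ∉ E2 := fun w hw => hE1' w (mem_sdiff.1 hw).1
  obtain ⟨f2, hf2, hf2z, hf2u⟩ := exists_labeling_of_remove_leaves hE2' hLul2 hβA (by simp) hf3 (by
    intro q hq hmem
    rw [wsum, ← hE3, hn3v, sum_empty, add_zero, ← hp3, hp3v,
      ← hq u (mem_singleton_self u), hp2u, mem_singleton] at hmem
    apply hgu
    linarith)
  have hs2v : wsum E2 p2 f2 v = p v + B.sum id + β := by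
    rw [hf2z v (by simpa using hne.symm), ← hE3, ← hp3, wsum, hn3v, sum_empty, add_zero, hp3v]
  have hs2u : wsum E2 p2 f2 u = p u + C.sum id + β := by
    have := hf2u u (mem_singleton_self u)
    rw [hp2u, mem_singleton] at this
    linarith
  obtain ⟨f1, hf1, hf1z, -⟩ := exists_labeling_of_remove_leaves hE1' hLvl1 hBA hBc hf2 (by
    intro q hq hmem
    have hq0 := hq w0 hw0
    rw [hp1, Function.update_of_ne (by rintro rfl; exact huLv hw0)] at hq0
    rw [← hE2, ← hp2, hs2v, ← hq0] at hmem
    apply hgB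
    rwa [show B.sum id + β - (p w0 - p v) = p v + B.sum id + β - p w0 by ring])
  obtain ⟨f, hf, -⟩ := exists_labeling_of_remove_leaves hE hul hCA hCc hf1 (by
    intro q hq hmem
    rw [← hE1, ← hp1, hf1z u huLv, ← hE2, ← hp2, hs2u, ← hq z0 hz0] at hmem
    apply hgC
    rwa [show C.sum id + β - (p z0 - p u) = p u + C.sum id + β - p z0 by ring])
  exact ⟨f, hf⟩

lemma exists_labeling_of_pendant_star {E : Finset (Sym2 V)} {p : V → ℤ} {A : Finset ℤ}
    (ih : LabelableBelow V #E) (hE : ∀ v, s(v, v) ∉ E) (hA : #A = #E) (hpos : ∀ a ∈ A, 0 < a)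
    (hsafe : ∀ z, ¬ IsUnsafe E p z) {u v : V} (huv : u ∈ nbrs E v)
    (hv : ((nbrs E v).erase u).Nonempty) (hvl : ∀ w ∈ (nbrs E v).erase u, nbrs E w = {v})
    (hu : nbrs E u ≠ {v}) (hdouble : ∃ w ∈ (nbrs E u).erase v, nbrs E w ≠ {u}) :
    ∃ f, IsWeightedLabeling E p A f := by
  have hne : u ≠ v := by rintro rfl; exact hE u (mem_nbrs.1 huv)
  set L := (nbrs E v).erase u with hL
  have hvL : v ∉ L := fun h => hE v (mem_nbrs.1 (mem_of_mem_erase h))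
  have huL : u ∉ L := notMem_erase _ _
  set E' := E \ starEdges v L with hE'
  have m : ∀ a b, b ∈ nbrs E' a ↔ b ∈ nbrs E a ∧ ¬ ((a = v ∧ b ∈ L) ∨ (b = v ∧ a ∈ L)) :=
    fun a b => mem_nbrs_sdiff
  have hcard := card_sdiff_starEdges (erase_subset u (nbrs E v))
  rw [← hL, ← hE'] at hcard
  have hLpos := hv.card_pos
  obtain ⟨w0, hw0⟩ := id hv
  obtain ⟨B, hB, hBc, hBx⟩ :=
    exists_subset_sum_exchange_ne A #L (by omega) (p w0 - p v)
  have hnv : nbrs E' v = {u} := by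
    ext y
    rw [m, mem_singleton]
    constructor
    · rintro ⟨h1, h2⟩
      by_contra h3
      exact h2 (Or.inl ⟨rfl, mem_erase.2 ⟨h3, h1⟩⟩)
    · rintro rfl
      exact ⟨huv, by tauto⟩
  have hother : ∀ y, y ≠ v → y ∉ L → nbrs E' y = nbrs E y := by
    intro y h1 h2
    ext w
    rw [m]
    tauto
  have hLE' : ∀ y ∈ L, nbrs E' y = ∅ := by
    intro y hy
    ext w
    rw [m, hvl y hy, mem_singleton]
    simp only [notMem_empty, iff_false]
    tauto
  set p' := Function.update p v (p v + B.sum id) with hp'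
  obtain ⟨f', hf'⟩ := ih E' p' (A \ B) (by omega) (fun w hw => hE w (mem_sdiff.1 hw).1)
    (by rw [card_sdiff_of_subset hB]; omega) (fun a ha => hpos a (mem_sdiff.1 ha).1) (by
      intro z hz
      by_cases hzv : z = v
      · subst hzv
        have := hz.2.1 u (by rw [hnv]; exact mem_singleton_self u)
        rw [hother u hne huL] at this
        exact hu this
      by_cases hzu : z = u
      · subst hzu
        obtain ⟨y, hy, hyn⟩ := hdouble
        rw [mem_erase] at hy
        have hyL : y ∉ L := by
          intro hyL
          have h1 := mem_nbrs_comm.1 hy.2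
          rw [hvl y hyL, mem_singleton] at h1
          exact hne h1
        have := hz.2.1 y (by rw [hother _ hne huL]; exact hy.2)
        rw [hother y hy.1 hyL] at this
        exact hyn this
      have key : ∀ y, y = z ∨ y ∈ nbrs E' z → y ≠ v ∧ y ∉ L := by
        rintro y (rfl | hy)
        · refine ⟨hzv, fun h => ?_⟩
          exact hz.1.ne_empty (hLE' _ h)
        · have h1 := mem_nbrs_comm.1 hy
          refine ⟨?_, fun h => ?_⟩
          · rintro rfl
            rw [hnv, mem_singleton] at h1
            exact hzu h1
          · rw [hLE' y h] at h1
            exact notMem_empty _ h1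
      exact not_isUnsafe_of_agree (hsafe z) (fun y hy => hother y (key y hy).1 (key y hy).2)
        (fun y hy => Function.update_of_ne (key y hy).1 _ _) hz)
  obtain ⟨f, hf, -⟩ := exists_labeling_of_remove_leaves hE hvl hB hBc hf' (by
    intro q hq hmem
    rw [← hE', ← hp', wsum, hnv, sum_singleton, hp', Function.update_self, ← hq w0 hw0] at hmem
    refine hBx (f' s(v, u)) ?_ ?_
    · rw [← hf'.2.1]
      apply mem_image_of_mem
      rw [← mem_nbrs, hnv]
      exact mem_singleton_self u
    · rwa [show B.sum id + f' s(v, u) - (p w0 - p v) = p v + B.sum id + f' s(v, u) - p w0 by ring])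
  exact ⟨f, hf⟩

/-- Moving weight between two vertices of an unsafe star makes it safe and creates no new
unsafe star. -/
lemma not_isUnsafe_of_transfer {E : Finset (Sym2 V)} (hE : ∀ v, s(v, v) ∉ E) {p p' : V → ℤ}
    {v u₁ u₂ : V} {d : ℤ} (hd : d ≠ 0) (hne : u₁ ≠ u₂) (h1 : p' u₁ = p u₁ + d)
    (h2 : p' u₂ = p u₂ - d) (hp : ∀ y, y ≠ u₁ → y ≠ u₂ → p' y = p y) (hv : IsUnsafe E p v)
    (hu₁ : u₁ ∈ nbrs E v) (hu₂ : u₂ = v ∨ u₂ ∈ nbrs E v) :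
    ¬ IsUnsafe E p' v ∧ ∀ z, IsUnsafe E p' z → IsUnsafe E p z := by
  have hvv : v ∉ nbrs E v := fun h => hE v (mem_nbrs.1 h)
  have hfix : ¬ IsUnsafe E p' v := by
    rintro ⟨-, -, q', hq', hc'⟩
    obtain ⟨-, -, q, hq, hc⟩ := hv
    have e1 := hq u₁ hu₁
    have e1' := hq' u₁ hu₁
    rcases hu₂ with rfl | hu₂
    · split_ifs at hc hc' with hcard
      · apply hd; linarith
      · obtain ⟨w, hw, hwu⟩ : ∃ w ∈ nbrs E u₂, w ≠ u₁ := by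
          by_contra hcon
          push Not at hcon
          exact hcard (card_eq_one.2 ⟨u₁, eq_singleton_iff_unique_mem.2 ⟨hu₁, hcon⟩⟩)
        have e2 := hq w hw
        have e2' := hq' w hw
        rw [hp w hwu (by rintro rfl; exact hvv hw)] at e2'
        apply hd; linarith
    · have e2 := hq u₂ hu₂
      have e2' := hq' u₂ hu₂
      apply hd; linarith
  refine ⟨hfix, fun z hz => ?_⟩
  have hzv : z ≠ v := by rintro rfl; exact hfix hz
  have hzn : z ∉ nbrs E v := by
    intro hzn
    have a1 := hv.2.1 z hzn
    have a2 := hz.2.1 v (mem_nbrs_comm.1 hzn)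
    apply hfix
    refine ⟨⟨z, hzn⟩, fun w hw => ?_, p' z, fun w hw => ?_, ?_⟩
    · rw [a2, mem_singleton] at hw; rw [hw, a1]
    · rw [a2, mem_singleton] at hw; rw [hw]
    · obtain ⟨q, hq, hc⟩ := hz.2.2
      rw [a1, card_singleton, if_pos rfl, ← hq v (mem_nbrs_comm.1 hzn)] at hc
      rw [a2, card_singleton, if_pos rfl, hc]
  have key : ∀ y, y = v ∨ y ∈ nbrs E v → y ≠ z ∧ y ∉ nbrs E z := by
    rintro y (rfl | hy)
    · exact ⟨hzv.symm, fun h => hzn (mem_nbrs_comm.1 h)⟩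
    · refine ⟨by rintro rfl; exact hzn hy, fun h => ?_⟩
      have b1 := hz.2.1 y h
      rw [hv.2.1 y hy, singleton_inj] at b1
      exact hzv b1.symm
  by_contra hcon
  refine not_isUnsafe_of_agree hcon (fun _ _ => rfl) (fun y hy => hp y ?_ ?_) hz
  · rintro rfl
    have := key y (Or.inr hu₁)
    exact hy.elim this.1 this.2
  · rintro rfl
    have := key y hu₂
    exact hy.elim this.1 this.2

/-- The edges at `x` can be labeled by `T` so that the rest of the graph becomes safe. -/
lemma exists_safe_star_labeling {E : Finset (Sym2 V)} (hE : ∀ v, s(v, v) ∉ E) (p : V → ℤ) {x : V}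
    (hstar : ∀ v, (nbrs E v).Nonempty → ∃ w ∈ nbrs E v, nbrs E w ≠ {v})
    (hpeel : ∀ v u, u ∈ nbrs E v → ((nbrs E v).erase u).Nonempty →
      ∃ w ∈ nbrs E v, w ≠ u ∧ nbrs E w ≠ {v})
    {T : Finset ℤ} (hT : #T = #(nbrs E x)) (hx : (nbrs E x).Nonempty) (a : ℤ) :
    ∃ h : V → ℤ, Set.InjOn h (nbrs E x) ∧ (nbrs E x).image h = T ∧
      (∀ y ∈ nbrs E x, nbrs E y = {x} → h y ≠ a) ∧
      ∀ z, ¬ IsUnsafe (E \ starEdges x (nbrs E x)) (fun y => p y + (if y = x then T.sum id else 0) +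
        (if y ∈ nbrs E x then h y else 0)) z := by
  set N := nbrs E x with hN
  set E' := E \ starEdges x N with hE'
  have hloop : ∀ v, s(v, v) ∉ E' := fun v hv => hE v (mem_sdiff.1 hv).1
  have m : ∀ a b, b ∈ nbrs E' a ↔ b ∈ nbrs E a ∧ a ≠ x ∧ b ≠ x := by
    intro a b
    rw [hE', mem_nbrs_sdiff]
    constructor
    · rintro ⟨h1, h2⟩
      push Not at h2
      refine ⟨h1, ?_, ?_⟩
      · rintro rfl; exact h2.1 rfl h1
      · rintro rfl; exact h2.2 rfl (mem_nbrs_comm.1 h1)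
    · rintro ⟨h1, h2, h3⟩
      exact ⟨h1, not_or.2 ⟨fun h => h2 h.1, fun h => h3 h.1⟩⟩
  have hxN : x ∉ N := fun h => hE x (mem_nbrs.1 h)
  set P : (V → ℤ) → V → ℤ := fun h y => p y + (if y = x then T.sum id else 0) +
    (if y ∈ N then h y else 0) with hP
  have step : ∀ n, ∀ h : V → ℤ, #(univ.filter fun z => IsUnsafe E' (P h) z) = n →
      Set.InjOn h N → N.image h = T → (∀ y ∈ N, nbrs E y = {x} → h y ≠ a) →
      ∃ h : V → ℤ, Set.InjOn h N ∧ N.image h = T ∧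
        (∀ y ∈ N, nbrs E y = {x} → h y ≠ a) ∧ ∀ z, ¬ IsUnsafe E' (P h) z := by
    intro n
    induction n using Nat.strong_induction_on with
    | _ n ih =>
      intro h hn hinj him ha
      by_cases hall : ∀ z, ¬ IsUnsafe E' (P h) z
      · exact ⟨h, hinj, him, ha, hall⟩
      push Not at hall
      obtain ⟨v, hv⟩ := hall
      have hvx : v ≠ x := by
        obtain ⟨w, hw⟩ := hv.1
        exact ((m _ _).1 hw).2.1
      have hleaf : ∀ w, w ∈ nbrs E v → w ∉ N → w ≠ x → nbrs E w = {v} := by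
        intro w hw hwN hwx
        have h1 := hv.2.1 w ((m _ _).2 ⟨hw, hvx, hwx⟩)
        rw [← h1]
        ext y
        rw [m]
        refine ⟨fun h => ⟨h, hwx, ?_⟩, fun h => h.1⟩
        rintro rfl
        exact hwN (mem_nbrs_comm.1 h)
      have hvne : (nbrs E v).Nonempty := by
        obtain ⟨w, hw⟩ := hv.1
        exact ⟨w, ((m _ _).1 hw).1⟩
      obtain ⟨u₁, hu₁, hu₁N⟩ : ∃ u₁ ∈ nbrs E' v, u₁ ∈ N := by
        by_contra hcon
        push Not at hcon
        by_cases hvN : v ∈ N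
        · obtain ⟨w, hw, hwx, hwv⟩ := hpeel v x (mem_nbrs_comm.1 hvN) (by
            obtain ⟨w, hw⟩ := hv.1
            have := (m _ _).1 hw
            exact ⟨w, mem_erase.2 ⟨this.2.2, this.1⟩⟩)
          exact hwv (hleaf w hw (hcon w ((m _ _).2 ⟨hw, hvx, hwx⟩)) hwx)
        · obtain ⟨w, hw, hwv⟩ := hstar v hvne
          have hwx : w ≠ x := by rintro rfl; exact hvN (mem_nbrs_comm.1 hw)
          exact hwv (hleaf w hw (hcon w ((m _ _).2 ⟨hw, hvx, hwx⟩)) hwx)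
      have hu₁E := ((m _ _).1 hu₁).1
      obtain ⟨u₂, hu₂N, hu₂ne, hu₂⟩ : ∃ u₂ ∈ N, u₂ ≠ u₁ ∧ (u₂ = v ∨ u₂ ∈ nbrs E' v) := by
        by_contra hcon
        push Not at hcon
        have hvu : v ≠ u₁ := by rintro rfl; exact hE _ (mem_nbrs.1 hu₁E)
        have hvN : v ∉ N := fun hvN => (hcon v hvN hvu).1 rfl
        have hxv : ∀ w ∈ nbrs E v, w ≠ x := by
          rintro w hw rfl; exact hvN (mem_nbrs_comm.1 hw)
        by_cases her : ((nbrs E v).erase u₁).Nonempty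
        · obtain ⟨w, hw, hwu, hwv⟩ := hpeel v u₁ hu₁E her
          refine hwv (hleaf w hw (fun hwN => ?_) (hxv w hw))
          exact (hcon w hwN hwu).2 ((m _ _).2 ⟨hw, hvx, hxv w hw⟩)
        · have hs : nbrs E v = {u₁} := by
            rw [not_nonempty_iff_eq_empty] at her
            rw [← insert_erase hu₁E, her]
            simp
          obtain ⟨w, hw, hwx, hwu⟩ := hpeel u₁ x (mem_nbrs_comm.1 hu₁N)
            ⟨v, mem_erase.2 ⟨hvx, mem_nbrs_comm.1 hu₁E⟩⟩
          have h1 := hv.2.1 u₁ hu₁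
          have h2 : w ∈ nbrs E' u₁ := (m _ _).2 ⟨hw, ((m _ _).1 hu₁).2.2, hwx⟩
          rw [h1, mem_singleton] at h2
          exact hwu (h2 ▸ hs)
      have hu₁x : u₁ ≠ x := fun h => hxN (h ▸ hu₁N)
      have hu₂x : u₂ ≠ x := fun h => hxN (h ▸ hu₂N)
      have hhne : h u₂ ≠ h u₁ := fun h => hu₂ne (hinj hu₂N hu₁N h)
      have hswapN : ∀ y ∈ N, Equiv.swap u₁ u₂ y ∈ N := by
        intro y hy
        rw [Equiv.swap_apply_def]
        split_ifs <;> assumption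
      set h' : V → ℤ := fun y => h (Equiv.swap u₁ u₂ y) with hh'
      have hnl : ∀ u, (nbrs E' u).Nonempty → nbrs E u ≠ {x} := by
        rintro u ⟨w, hw⟩ hu
        have := (m _ _).1 hw
        rw [hu, mem_singleton] at this
        exact this.2.2 this.1
      have hnl₁ := hnl u₁ ⟨v, mem_nbrs_comm.1 hu₁⟩
      have hnl₂ : nbrs E u₂ ≠ {x} := by
        rcases hu₂ with h | h
        · exact hnl u₂ (h ▸ hv.1)
        · exact hnl u₂ ⟨v, mem_nbrs_comm.1 h⟩
      have htr := not_isUnsafe_of_transfer (p' := P h') (d := h u₂ - h u₁) hloop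
        (sub_ne_zero.2 hhne) hu₂ne.symm
        (by simp only [hP, hh', Equiv.swap_apply_left, if_pos hu₁N]; ring)
        (by simp only [hP, hh', Equiv.swap_apply_right, if_pos hu₂N]; ring)
        (fun y h1 h2 => by simp only [hP, hh', Equiv.swap_apply_of_ne_of_ne h1 h2]) hv hu₁ hu₂
      refine ih _ ?_ h' rfl ?_ ?_ ?_
      · rw [← hn]
        apply card_lt_card
        refine ⟨fun z hz => ?_, fun hsub => ?_⟩
        · simp only [mem_filter, mem_univ, true_and] at hz ⊢
          exact htr.2 z hz
        · have := hsub (mem_filter.2 ⟨mem_univ v, hv⟩)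
          exact htr.1 (mem_filter.1 this).2
      · intro y hy z hz hyz
        exact (Equiv.swap u₁ u₂).injective (hinj (hswapN y hy) (hswapN z hz) hyz)
      · rw [← him]
        ext t
        simp only [mem_image]
        constructor
        · rintro ⟨y, hy, rfl⟩
          exact ⟨_, hswapN y hy, rfl⟩
        · rintro ⟨y, hy, rfl⟩
          exact ⟨_, hswapN y hy, by simp only [hh', Equiv.swap_apply_self]⟩
      · intro y hy hyl
        have h1 : y ≠ u₁ := by rintro rfl; exact hnl₁ hyl
        have h2 : y ≠ u₂ := by rintro rfl; exact hnl₂ hyl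
        simp only [hh', Equiv.swap_apply_of_ne_of_ne h1 h2]
        exact ha y hy hyl
  obtain ⟨t, ht⟩ := Infinite.exists_notMem_finset T
  obtain ⟨y₀, hy₀, hy₀l⟩ := hstar x hx
  obtain ⟨h, hinj, him, hne⟩ := exists_labels_avoiding N T hT.symm
    (fun y => if nbrs E y = {x} then a else t) (by
      rintro ⟨b, hb, hall⟩
      have := hall y₀ hy₀
      rw [if_neg hy₀l] at this
      exact ht (this ▸ hb))
  exact step _ h rfl hinj him fun y hy hyl => by
    have := hne y hy
    rwa [if_pos hyl] at this

lemma exists_labeling_of_no_stars {E : Finset (Sym2 V)} {p : V → ℤ} {A : Finset ℤ}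
    (ih : LabelableBelow V #E) (hE : ∀ v, s(v, v) ∉ E) (hA : #A = #E) (hpos : ∀ a ∈ A, 0 < a)
    (hstar : ∀ v, (nbrs E v).Nonempty → ∃ w ∈ nbrs E v, nbrs E w ≠ {v})
    (hpeel : ∀ v u, u ∈ nbrs E v → ((nbrs E v).erase u).Nonempty →
      ∃ w ∈ nbrs E v, w ≠ u ∧ nbrs E w ≠ {v})
    (hne : ∃ v, (nbrs E v).Nonempty) : ∃ f, IsWeightedLabeling E p A f := by
  have hdeg : ∀ v, #(nbrs E v) ≤ #A := by
    intro v
    have := card_sdiff_starEdges (subset_refl (nbrs E v))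
    omega
  have htop : ∀ r, ∃ T : Finset ℤ, r ≤ #A → T ⊆ A ∧ #T = r ∧ ∀ a ∈ T, ∀ b ∈ A, b ∉ T → b < a := by
    intro r
    by_cases hr : r ≤ #A
    · obtain ⟨T, hT⟩ := exists_top_subset A r hr
      exact ⟨T, fun _ => hT⟩
    · exact ⟨∅, fun h => absurd h hr⟩
  choose top htop using htop
  have hT := fun v => htop _ (hdeg v)
  set Q : V → ℤ := fun v => p v + (top #(nbrs E v)).sum id with hQ
  obtain ⟨x, hx, hmax⟩ := exists_max_image (univ.filter fun v => (nbrs E v).Nonempty)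
    (fun v => toLex (Q v, #(nbrs E v))) (by
      obtain ⟨v, hv⟩ := hne
      exact ⟨v, mem_filter.2 ⟨mem_univ _, hv⟩⟩)
  replace hx := (mem_filter.1 hx).2
  obtain ⟨a, ha⟩ : ∃ a, top 1 = {a} :=
    card_eq_one.1 (htop 1 (hx.card_pos.trans_le (hdeg x))).2.1
  set N := nbrs E x with hN
  have hxN : x ∉ N := fun h => hE x (mem_nbrs.1 h)
  obtain ⟨hTA, hTc, hTtop⟩ := hT x
  obtain ⟨h, hinj, him, hha, hsafe⟩ := exists_safe_star_labeling hE p hstar hpeel hTc hx a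
  rw [← hN] at *
  set T := top #N with hTdef
  have hcard := card_sdiff_starEdges (subset_refl N)
  have hNpos := hx.card_pos
  obtain ⟨f', hf'⟩ := ih (E \ starEdges x N) _ (A \ T) (by omega)
    (fun w hw => hE w (mem_sdiff.1 hw).1) (by rw [card_sdiff_of_subset hTA]; omega)
    (fun b hb => hpos b (mem_sdiff.1 hb).1) hsafe
  obtain ⟨f, hf1, hf2, hf3, hf4⟩ := exists_merged_labeling hE p (subset_refl N) hTA hinj him
    hf'.1 hf'.2.1
  have hnx : nbrs (E \ starEdges x N) x = ∅ := by
    refine eq_empty_of_forall_notMem fun y hy => ?_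
    rw [mem_nbrs_sdiff] at hy
    exact hy.2 (Or.inl ⟨rfl, hy.1⟩)
  have hwx : wsum E p f x = Q x := by
    rw [hf3, wsum, hnx, sum_empty, if_pos rfl, if_neg hxN]
    simp only [hQ]
    ring
  have hconf : ∀ y ∈ N, wsum E p f y ≠ Q x := by
    intro y hy heq
    have hyx : y ≠ x := fun h => hxN (h ▸ hy)
    have hyne : (nbrs E y).Nonempty := ⟨x, mem_nbrs_comm.1 hy⟩
    set S := (nbrs E y).image fun w => f s(y, w) with hS
    have hSinj : Set.InjOn (fun w => f s(y, w)) (nbrs E y) := by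
      intro w hw w' hw' hww
      have := hf1 (mem_nbrs.1 hw) (mem_nbrs.1 hw') hww
      rcases Sym2.eq_iff.1 this with h | h
      · exact h.2
      · exact h.2.trans h.1
    have hSc : #S = #(nbrs E y) := card_image_of_injOn hSinj
    have hSs : wsum E p f y = p y + S.sum id := by
      rw [wsum, hS, sum_image hSinj]
      rfl
    have hSA : S ⊆ A := by
      intro b hb
      obtain ⟨w, hw, rfl⟩ := mem_image.1 hb
      rw [← hf2]
      exact mem_image_of_mem _ (mem_nbrs.1 hw)
    obtain ⟨hTyA, hTyc, hTytop⟩ := hT y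
    have hlex := hmax y (mem_filter.2 ⟨mem_univ _, hyne⟩)
    rw [Prod.Lex.toLex_le_toLex] at hlex
    have hQy : Q y = p y + (top #(nbrs E y)).sum id := rfl
    have hSeq : S = top #(nbrs E y) := by
      by_contra hSne
      have h1 := sum_lt_sum_top hTytop hSA (hSc.trans hTyc.symm) hSne
      rcases hlex with h2 | ⟨h2, -⟩
      · linarith
      · simp only at h2
        linarith
    have hdle : #(nbrs E y) ≤ #N := by
      rcases hlex with h2 | ⟨-, h2⟩
      · rw [hSeq] at hSs
        simp only at h2
        linarith
      · exact h2
    have hST : S ⊆ T := by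
      rw [hSeq]
      exact top_subset_top hTytop hTtop hTyA hTA (by rw [hTyc, hTc]; exact hdle)
    have hyl : nbrs E y = {x} := by
      refine eq_singleton_iff_unique_mem.2 ⟨mem_nbrs_comm.1 hy, fun w hw => ?_⟩
      have h1 : f s(y, w) ∈ T := hST (mem_image_of_mem (fun w => f s(y, w)) hw)
      rw [← him] at h1
      obtain ⟨w', hw', h2⟩ := mem_image.1 h1
      rw [← hf4 w' hw'] at h2
      rcases Sym2.eq_iff.1 (hf1 (mem_nbrs.1 hw') (mem_nbrs.1 hw) h2) with h3 | h3
      · exact absurd h3.1.symm hyx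
      · exact h3.1.symm
    apply hha y hy hyl
    rw [hS, hyl, image_singleton, card_singleton, ha, singleton_inj, Sym2.eq_swap, hf4 y hy] at hSeq
    exact hSeq
  refine ⟨f, hf1, hf2, fun u v huv => ?_⟩
  by_cases hux : u = x
  · subst hux
    rw [hwx]
    exact (hconf v (mem_nbrs.2 huv)).symm
  by_cases hvx : v = x
  · subst hvx
    rw [hwx]
    exact hconf u (mem_nbrs_comm.1 (mem_nbrs.2 huv))
  rw [hf3, hf3]
  apply hf'.2.2
  rw [mem_sdiff, mk_mem_starEdges]
  exact ⟨huv, not_or.2 ⟨fun h => hux h.1, fun h => hvx h.1⟩⟩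

/-- Every safe weighted graph has a weighted labeling. -/
theorem labelableBelow (n : ℕ) : LabelableBelow V n := by
  induction n with
  | zero => exact fun E p A h => absurd h (Nat.not_lt_zero _)
  | succ n ih =>
    intro E p A hn hE hA hpos hsafe
    replace ih : LabelableBelow V #E := fun E' p' A' h => ih E' p' A' (by omega)
    by_cases hne : ∃ v, (nbrs E v).Nonempty
    swap
    · push Not at hne
      have hE0 : E = ∅ := by
        refine eq_empty_of_forall_notMem fun e => ?_
        induction e with
        | _ v w => exact fun h => notMem_empty w (hne v ▸ mem_nbrs.2 h)
      subst hE0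
      rw [card_empty, card_eq_zero] at hA
      exact ⟨0, by simp [IsWeightedLabeling, hA]⟩
    by_cases hstar : ∃ v, (nbrs E v).Nonempty ∧ ∀ w ∈ nbrs E v, nbrs E w = {v}
    · obtain ⟨v, hv, hleaf⟩ := hstar
      exact exists_labeling_of_star_component ih hE hA hpos hsafe hv hleaf
    push Not at hstar
    by_cases hpeel : ∃ v u, u ∈ nbrs E v ∧ ((nbrs E v).erase u).Nonempty ∧
        ∀ w ∈ nbrs E v, w ≠ u → nbrs E w = {v}
    · obtain ⟨v, u, huv, hv, hvl⟩ := hpeel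
      replace hvl : ∀ w ∈ (nbrs E v).erase u, nbrs E w = {v} := fun w hw =>
        hvl w (mem_of_mem_erase hw) (ne_of_mem_erase hw)
      have hu : nbrs E u ≠ {v} := by
        intro hu
        obtain ⟨w, hw, hwv⟩ := hstar v ⟨u, huv⟩
        by_cases hwu : w = u
        · exact hwv (hwu ▸ hu)
        · exact hwv (hvl w (mem_erase.2 ⟨hwu, hw⟩))
      by_cases hul : ∀ w ∈ (nbrs E u).erase v, nbrs E w = {u}
      · refine exists_labeling_of_double_star_component ih hE hA hpos hsafe huv hv ?_ hvl hul
        rw [nonempty_iff_ne_empty]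
        intro h
        rw [← insert_erase (mem_nbrs_comm.1 huv), h] at hu
        exact hu (insert_empty_eq v)
      · push Not at hul
        exact exists_labeling_of_pendant_star ih hE hA hpos hsafe huv hv hvl hu hul
    · push Not at hpeel
      exact exists_labeling_of_no_stars ih hE hA hpos hstar hpeel hne

end WeightedLabelings

lemma nonempty_iso_top_of_isolated_edge {G : SimpleGraph V} (hconn : G.Connected) {a b : V}
    (hab : G.Adj a b) (ha : ∀ w, G.Adj a w → w = b) (hb : ∀ w, G.Adj b w → w = a) :
    Nonempty (G ≃g (⊤ : SimpleGraph (Fin 2))) := by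
  have hV : ∀ v, v = a ∨ v = b := by
    intro v
    have h := (SimpleGraph.reachable_iff_reflTransGen a v).1 (hconn.preconnected a v)
    induction h with
    | refl => exact Or.inl rfl
    | tail _ hadj ih =>
      rcases ih with rfl | rfl
      · exact Or.inr (ha _ hadj)
      · exact Or.inl (hb _ hadj)
  have hne := hab.ne
  refine ⟨⟨⟨fun v => if v = a then 0 else 1, fun i => if i = 0 then a else b, ?_, ?_⟩, ?_⟩⟩
  · intro v
    rcases hV v with rfl | rfl
    · simp
    · simp [hne.symm]
  · intro i
    fin_cases i
    · simp
    · simp [hne.symm]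
  · intro v w
    rcases hV v with rfl | rfl <;> rcases hV w with rfl | rfl <;>
      simp [hne.symm, hab, hab.symm]

lemma mem_nbrs_edgeFinset [Fintype V] {G : SimpleGraph V} {v w : V} :
    w ∈ nbrs G.edgeFinset v ↔ G.Adj v w := by
  rw [mem_nbrs, SimpleGraph.mem_edgeFinset, SimpleGraph.mem_edgeSet]

lemma vertexSum_eq_sum_nbrs [Fintype V] (G : SimpleGraph V) (f : Sym2 V → ℕ) (v : V) :
    vertexSum G f v = ∑ w ∈ nbrs G.edgeFinset v, f s(v, w) := by
  have : G.incidenceFinset v = (nbrs G.edgeFinset v).image fun w => s(v, w) := by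
    ext e
    rw [SimpleGraph.mem_incidenceFinset, mem_image]
    constructor
    · rintro ⟨he, hv⟩
      obtain ⟨w, rfl⟩ := Sym2.mem_iff_exists.1 hv
      exact ⟨w, mem_nbrs_edgeFinset.2 he, rfl⟩
    · rintro ⟨w, hw, rfl⟩
      exact ⟨mem_nbrs_edgeFinset.1 hw, Sym2.mem_mk_left v w⟩
  rw [vertexSum, this, sum_image]
  intro a _ b _ h
  rcases Sym2.eq_iff.1 h with h | h
  · exact h.2
  · exact h.2.trans h.1

/-- Every connected graph other than `K₂` is local antimagic. -/
theorem exists_isLocalAntimagic [Fintype V] {G : SimpleGraph V} (hconn : G.Connected)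
    (hK2 : ¬ Nonempty (G ≃g (⊤ : SimpleGraph (Fin 2)))) : ∃ f, IsLocalAntimagic G f := by
  have hE : ∀ v, s(v, v) ∉ G.edgeFinset := fun v h => by simp at h
  obtain ⟨f, hinj, him, hadj⟩ := labelableBelow (#G.edgeFinset + 1) G.edgeFinset 0
    ((Icc 1 #G.edgeFinset).image Nat.cast) (Nat.lt_succ_self _) hE
    (by rw [card_image_of_injective _ Nat.cast_injective, Nat.card_Icc, Nat.add_sub_cancel])
    (by
      intro a ha
      obtain ⟨n, hn, rfl⟩ := mem_image.1 ha
      have := (mem_Icc.1 hn).1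
      omega)
    (by
      rintro z ⟨⟨w, hw⟩, hleaf, q, hq, hc⟩
      have hq0 : q = 0 := (hq w hw).symm
      rw [hq0] at hc
      split_ifs at hc with hcard
      · have hzw := mem_nbrs_edgeFinset.1 hw
        refine hK2 (nonempty_iso_top_of_isolated_edge hconn hzw (fun y hy => ?_) fun y hy => ?_)
        · exact card_le_one.1 hcard.le y (mem_nbrs_edgeFinset.2 hy) w hw
        · rw [← mem_nbrs_edgeFinset, hleaf w hw, mem_singleton] at hy
          exact hy
      · exact lt_irrefl _ hc)
  have hmem : ∀ e ∈ G.edgeFinset, ∃ n ∈ Icc 1 #G.edgeFinset, (n : ℤ) = f e := by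
    intro e he
    have := mem_image_of_mem f he
    rw [him] at this
    exact mem_image.1 this
  have hcast : ∀ e ∈ G.edgeFinset, ((f e).toNat : ℤ) = f e := by
    intro e he
    obtain ⟨n, -, hn⟩ := hmem e he
    rw [← hn, Int.toNat_natCast]
  refine ⟨fun e => (f e).toNat, ⟨?_, ?_, ?_⟩, ?_⟩
  · intro e he
    obtain ⟨n, hn, hn'⟩ := hmem e (SimpleGraph.mem_edgeFinset.2 he)
    rw [mem_Icc] at hn
    simp only [← hn', Int.toNat_natCast]
    exact hn
  · intro e he e' he' h
    rw [← SimpleGraph.mem_edgeFinset] at he he'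
    apply hinj he he'
    rw [← hcast e he, ← hcast e' he']
    exact congrArg Nat.cast h
  · intro n hn
    have : (n : ℤ) ∈ G.edgeFinset.image f := by
      rw [him]
      exact mem_image_of_mem _ (mem_Icc.2 hn)
    obtain ⟨e, he, hen⟩ := mem_image.1 this
    refine ⟨e, SimpleGraph.mem_edgeFinset.1 he, ?_⟩
    simp only [hen, Int.toNat_natCast]
  · have hsum : ∀ v, (vertexSum G (fun e => (f e).toNat) v : ℤ) = wsum G.edgeFinset 0 f v := by
      intro v
      rw [vertexSum_eq_sum_nbrs, wsum, Nat.cast_sum, Pi.zero_apply, zero_add]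
      exact sum_congr rfl fun w hw => hcast _ (mem_nbrs.1 hw)
    intro u v huv h
    apply hadj u v (by simpa using huv)
    rw [← hsum, ← hsum, h]

/-- A local antimagic labeling of a connected graph other than `K₂` uses more colors than there
are pendant vertices. -/
lemma pendantCount_lt_colorCount [Fintype V] {G : SimpleGraph V} (hconn : G.Connected)
    (hK2 : ¬ Nonempty (G ≃g (⊤ : SimpleGraph (Fin 2)))) {f : Sym2 V → ℕ}
    (hf : IsLocalAntimagic G f) : pendantCount G < colorCount G f := by
  obtain ⟨⟨hmaps, hinj, hsurj⟩, -⟩ := hf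
  have hpend : ∀ v, IsPendant G v → ∃ w, G.Adj v w ∧ (∀ y, G.Adj v y → y = w) ∧
      vertexSum G f v = f s(v, w) := by
    intro v hv
    obtain ⟨w, hw⟩ := card_eq_one.1 ((G.card_neighborFinset_eq_degree v).trans hv)
    have hiff : ∀ y, G.Adj v y ↔ y = w := by
      intro y
      rw [← SimpleGraph.mem_neighborFinset, hw, mem_singleton]
    refine ⟨w, (hiff w).2 rfl, fun y hy => (hiff y).1 hy, ?_⟩
    rw [vertexSum_eq_sum_nbrs, eq_singleton_iff_unique_mem.2
      ⟨mem_nbrs_edgeFinset.2 ((hiff w).2 rfl), fun y hy =>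
        (hiff y).1 (mem_nbrs_edgeFinset.1 hy)⟩, sum_singleton]
  have hpinj : Set.InjOn (vertexSum G f) (univ.filter fun v => IsPendant G v) := by
    intro v hv v' hv' h
    obtain ⟨w, hvw, huniq, hs⟩ := hpend v (mem_filter.1 hv).2
    obtain ⟨w', hvw', huniq', hs'⟩ := hpend v' (mem_filter.1 hv').2
    rw [hs, hs'] at h
    rcases Sym2.eq_iff.1 (hinj hvw hvw' h) with h | h
    · exact h.1
    · obtain ⟨rfl, rfl⟩ := h
      exact absurd (nonempty_iso_top_of_isolated_edge hconn hvw huniq huniq') hK2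
  have hbig : ∀ u w, G.Adj u w → f s(u, w) = #G.edgeFinset → ¬ IsPendant G u →
      #G.edgeFinset < vertexSum G f u := by
    intro u w huw hm hu
    obtain ⟨y, hy, hyw⟩ : ∃ y, G.Adj u y ∧ y ≠ w := by
      by_contra hcon
      push Not at hcon
      apply hu
      rw [IsPendant, ← SimpleGraph.card_neighborFinset_eq_degree]
      exact card_eq_one.2 ⟨w, eq_singleton_iff_unique_mem.2
        ⟨(G.mem_neighborFinset u w).2 huw, fun y hy => hcon y ((G.mem_neighborFinset u y).1 hy)⟩⟩
    have hpos : 1 ≤ f s(u, y) := (hmaps hy).1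
    have hsub : ({w, y} : Finset V) ⊆ nbrs G.edgeFinset u := by
      intro z hz
      rcases mem_insert.1 hz with rfl | hz
      · exact mem_nbrs_edgeFinset.2 huw
      · rw [mem_singleton.1 hz]
        exact mem_nbrs_edgeFinset.2 hy
    have hle := sum_le_sum_of_subset (f := fun z => f s(u, z)) hsub
    rw [sum_pair hyw.symm, ← vertexSum_eq_sum_nbrs] at hle
    omega
  obtain ⟨c, hc⟩ : ∃ c, ∀ v, IsPendant G v → vertexSum G f v ≠ vertexSum G f c := by
    have hle : ∀ v, IsPendant G v → 1 ≤ #G.edgeFinset ∧ vertexSum G f v ≤ #G.edgeFinset := by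
      intro v hv
      obtain ⟨w, hvw, -, hs⟩ := hpend v hv
      have := hmaps (SimpleGraph.mem_edgeSet G |>.2 hvw)
      rw [hs]
      exact ⟨this.1.trans this.2, this.2⟩
    by_cases hm : 1 ≤ #G.edgeFinset
    · obtain ⟨e, he, hem⟩ := hsurj (Set.mem_Icc.2 ⟨hm, le_rfl⟩)
      induction e with
      | _ u w =>
        replace he : G.Adj u w := he
        by_cases hu : IsPendant G u
        · by_cases hw : IsPendant G w
          · obtain ⟨w', -, hu1, -⟩ := hpend u hu
            obtain ⟨u', -, hw1, -⟩ := hpend w hw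
            refine absurd (nonempty_iso_top_of_isolated_edge hconn he ?_ ?_) hK2
            · intro y hy
              rw [hu1 y hy, hu1 w he]
            · intro y hy
              rw [hw1 y hy, hw1 u he.symm]
          · exact ⟨w, fun v hv => ((hle v hv).2.trans_lt
              (hbig w u he.symm (Sym2.eq_swap ▸ hem) hw)).ne⟩
        · exact ⟨u, fun v hv => ((hle v hv).2.trans_lt (hbig u w he hem hu)).ne⟩
    · obtain ⟨c⟩ := hconn.nonempty
      exact ⟨c, fun v hv => absurd (hle v hv).1 hm⟩
  rw [pendantCount, colorCount, ← card_image_of_injOn hpinj]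
  apply card_lt_card
  refine ⟨image_subset_image (subset_univ _), fun hsub => ?_⟩
  obtain ⟨v, hv, hvc⟩ := mem_image.1 (hsub (mem_image_of_mem _ (mem_univ c)))
  exact hc v (mem_filter.1 hv).2 hvc

/-- Theorem: lower bound for graphs with pendants.
If `G` is a connected graph with exactly `k` pendant vertices and `G` is not isomorphic
to `K₂`, then `χ_la(G) ≥ k + 1`. -/
theorem chiLA_ge_pendant_add_one [Fintype V] (G : SimpleGraph V)
    (hconn : G.Connected) (k : ℕ) (hk : pendantCount G = k)
    (hK2 : ¬ Nonempty (G ≃g (⊤ : SimpleGraph (Fin 2)))) :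
    k + 1 ≤ chiLA G := by
  obtain ⟨f, hf⟩ := exists_isLocalAntimagic hconn hK2
  refine le_csInf ⟨_, f, hf, rfl⟩ ?_
  rintro n ⟨g, hg, rfl⟩
  exact hk ▸ pendantCount_lt_colorCount hconn hK2 hg

end LocalAntimagic
end

section
/- For the spider Sp(2^[3]) (the tree on 7 vertices obtained from the star K_{1,3} by subdividing each edge once), χ_la(Sp(2^[3])) = 4. -/
open Finset
open scoped Classical

namespace LocalAntimagic

variable {V : Type*}

/-- Vertices of the spider `Sp(2^[n])`: a core vertex `u`, the middle vertices `vᵢ`,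
and the pendant (leaf) vertices `wᵢ`. -/
inductive SpVert (n : ℕ) : Type
  | core : SpVert n
  | mid (i : Fin n) : SpVert n
  | leaf (i : Fin n) : SpVert n
  deriving DecidableEq, Fintype

/-- The spider `Sp(2^[n])`: the star `K_{1,n}` with every edge subdivided once.
The core is adjacent to each `vᵢ`, and each `vᵢ` is adjacent to the pendant `wᵢ`. -/
def spider2 (n : ℕ) : SimpleGraph (SpVert n) :=
  SimpleGraph.fromRel (fun a b =>
    (∃ i : Fin n, a = SpVert.core ∧ b = SpVert.mid i) ∨
    (∃ i : Fin n, a = SpVert.mid i ∧ b = SpVert.leaf i))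

/-- The edges of the spider: `inl i` is the edge from the core to `vᵢ`, and `inr i` is the
pendant edge from `vᵢ` to `wᵢ`. -/
def spiderEdge (n : ℕ) : Fin n ⊕ Fin n → Sym2 (SpVert n)
  | .inl i => s(.core, .mid i)
  | .inr i => s(.mid i, .leaf i)

lemma spiderEdge_injective (n : ℕ) : Function.Injective (spiderEdge n) := by
  rintro (i | i) (j | j) h <;> simp_all [spiderEdge]

lemma spider2_adj_core_mid {n : ℕ} (i : Fin n) : (spider2 n).Adj .core (.mid i) := by
  simp [spider2]

lemma spider2_adj_mid_leaf {n : ℕ} (i : Fin n) : (spider2 n).Adj (.mid i) (.leaf i) := by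
  simp [spider2]

lemma edgeSet_spider2 (n : ℕ) : (spider2 n).edgeSet = Set.range (spiderEdge n) := by
  ext e
  constructor
  · induction e using Sym2.ind with
    | _ a b =>
      rintro ⟨-, (⟨i, rfl, rfl⟩ | ⟨i, rfl, rfl⟩) | (⟨i, rfl, rfl⟩ | ⟨i, rfl, rfl⟩)⟩
      · exact ⟨.inl i, rfl⟩
      · exact ⟨.inr i, rfl⟩
      · exact ⟨.inl i, Sym2.eq_swap⟩
      · exact ⟨.inr i, Sym2.eq_swap⟩
  · rintro ⟨i | i, rfl⟩
    · exact spider2_adj_core_mid i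
    · exact spider2_adj_mid_leaf i

lemma card_edgeFinset_spider2 (n : ℕ) : (spider2 n).edgeFinset.card = n + n := by
  have h : (spider2 n).edgeFinset = univ.image (spiderEdge n) := by
    ext e
    simp [edgeSet_spider2]
  rw [h, card_image_of_injective _ (spiderEdge_injective n)]
  simp

lemma vertexSum_spider2 {n : ℕ} (f : Sym2 (SpVert n) → ℕ) (v : SpVert n) :
    vertexSum (spider2 n) f v =
      ∑ x : Fin n ⊕ Fin n, if v ∈ spiderEdge n x then f (spiderEdge n x) else 0 := by
  rw [vertexSum, ← sum_filter, ← sum_image (f := f) (spiderEdge_injective n).injOn]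
  refine sum_congr ?_ fun _ _ => rfl
  ext e
  rw [SimpleGraph.mem_incidenceFinset, SimpleGraph.incidenceSet, edgeSet_spider2]
  simp only [mem_image, mem_filter, mem_univ, true_and]
  constructor
  · rintro ⟨⟨x, rfl⟩, hv⟩
    exact ⟨x, hv, rfl⟩
  · rintro ⟨x, hv, rfl⟩
    exact ⟨⟨x, rfl⟩, hv⟩

lemma vertexSum_core {n : ℕ} (f : Sym2 (SpVert n) → ℕ) :
    vertexSum (spider2 n) f .core = ∑ i, f (spiderEdge n (.inl i)) := by
  simp [vertexSum_spider2, spiderEdge]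

lemma vertexSum_mid {n : ℕ} (f : Sym2 (SpVert n) → ℕ) (i : Fin n) :
    vertexSum (spider2 n) f (.mid i) =
      f (spiderEdge n (.inl i)) + f (spiderEdge n (.inr i)) := by
  simp [vertexSum_spider2, spiderEdge]

lemma vertexSum_leaf {n : ℕ} (f : Sym2 (SpVert n) → ℕ) (i : Fin n) :
    vertexSum (spider2 n) f (.leaf i) = f (spiderEdge n (.inr i)) := by
  simp [vertexSum_spider2, spiderEdge]

/-- The pendant vertices receive `n` distinct colors, all at most `2n`, while the vertex `vᵢ` on the
edge labeled `2n` receives a color exceeding `2n`. -/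
lemma succ_le_colorCount_spider2 {n : ℕ} (hn : 0 < n) {f : Sym2 (SpVert n) → ℕ}
    (hf : IsLocalAntimagic (spider2 n) f) : n + 1 ≤ colorCount (spider2 n) f := by
  obtain ⟨⟨hmaps, hinj, hsurj⟩, -⟩ := hf
  rw [card_edgeFinset_spider2, edgeSet_spider2] at hmaps hsurj
  rw [edgeSet_spider2] at hinj
  have hb (x) : 1 ≤ f (spiderEdge n x) ∧ f (spiderEdge n x) ≤ n + n := hmaps ⟨x, rfl⟩
  obtain ⟨i, hi⟩ : ∃ i, n + n < vertexSum (spider2 n) f (.mid i) := by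
    obtain ⟨_, ⟨i | i, rfl⟩, hx⟩ := hsurj (show n + n ∈ Set.Icc 1 (n + n) from ⟨by lia, le_rfl⟩)
    all_goals
      refine ⟨i, ?_⟩
      rw [vertexSum_mid]
      have := hb (.inl i)
      have := hb (.inr i)
      lia
  have hleaf : Function.Injective fun j => vertexSum (spider2 n) f (.leaf j) := by
    intro j k hjk
    simp only [vertexSum_leaf] at hjk
    exact Sum.inr_injective (spiderEdge_injective n (hinj ⟨_, rfl⟩ ⟨_, rfl⟩ hjk))
  have hnot : vertexSum (spider2 n) f (.mid i) ∉
      univ.image fun j => vertexSum (spider2 n) f (.leaf j) := by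
    simp only [mem_image, mem_univ, true_and, not_exists]
    intro j hj
    rw [vertexSum_leaf] at hj
    have := (hb (.inr j)).2
    lia
  calc n + 1 = (insert (vertexSum (spider2 n) f (.mid i))
        (univ.image fun j => vertexSum (spider2 n) f (.leaf j))).card := by
        rw [card_insert_of_notMem hnot, card_image_of_injective _ hleaf, card_fin]
    _ ≤ colorCount (spider2 n) f := by
        refine card_le_card fun c hc => ?_
        simp only [mem_insert, mem_image, mem_univ, true_and] at hc ⊢
        rcases hc with rfl | ⟨j, rfl⟩
        exacts [⟨_, rfl⟩, ⟨_, rfl⟩]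

/-- Labels of the edges of `Sp(2^[3])` inducing only the colors `4, 5, 6, 8`. -/
def spiderThreeLabel : Fin 3 ⊕ Fin 3 → ℕ :=
  Sum.elim ![1, 3, 2] ![4, 5, 6]

lemma exists_isLocalAntimagic_colorCount_le_four :
    ∃ f, IsLocalAntimagic (spider2 3) f ∧ colorCount (spider2 3) f ≤ 4 := by
  have hE := spiderEdge_injective 3
  set f : Sym2 (SpVert 3) → ℕ := Function.extend (spiderEdge 3) spiderThreeLabel 0
  have hf (x) : f (spiderEdge 3 x) = spiderThreeLabel x := hE.extend_apply _ _ x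
  have hcore : vertexSum (spider2 3) f .core = 6 := by
    simp [vertexSum_core, hf, Fin.sum_univ_three, spiderThreeLabel]
  have hmid (i) : vertexSum (spider2 3) f (.mid i) = ![5, 8, 8] i := by
    fin_cases i <;> simp [vertexSum_mid, hf, spiderThreeLabel]
  have hleaf (i) : vertexSum (spider2 3) f (.leaf i) = ![4, 5, 6] i := by
    simp [vertexSum_leaf, hf, spiderThreeLabel]
  refine ⟨f, ⟨⟨?_, ?_, ?_⟩, ?_⟩, ?_⟩
  · rw [edgeSet_spider2, card_edgeFinset_spider2]
    rintro _ ⟨x, rfl⟩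
    rw [hf, Set.mem_Icc]
    revert x
    decide
  · rw [edgeSet_spider2]
    rintro _ ⟨x, rfl⟩ _ ⟨y, rfl⟩ h
    rw [hf, hf] at h
    congr 1
    revert x y
    decide
  · rw [edgeSet_spider2, card_edgeFinset_spider2]
    rintro k ⟨hk₁, hk₂⟩
    obtain ⟨x, hx⟩ : ∃ x, spiderThreeLabel x = k := by
      interval_cases k <;> decide
    exact ⟨_, ⟨x, rfl⟩, (hf x).trans hx⟩
  · have hcm (i) : vertexSum (spider2 3) f .core ≠ vertexSum (spider2 3) f (.mid i) := by
      rw [hcore, hmid]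
      revert i
      decide
    have hml (i) : vertexSum (spider2 3) f (.mid i) ≠ vertexSum (spider2 3) f (.leaf i) := by
      rw [hmid, hleaf]
      revert i
      decide
    rintro u v ⟨-, (⟨i, rfl, rfl⟩ | ⟨i, rfl, rfl⟩) | (⟨i, rfl, rfl⟩ | ⟨i, rfl, rfl⟩)⟩
    exacts [hcm i, hml i, (hcm i).symm, (hml i).symm]
  · refine (card_le_card (t := {4, 5, 6, 8}) fun c hc => ?_).trans card_le_four
    obtain ⟨v, -, rfl⟩ := mem_image.mp hc
    cases v with
    | core => simp [hcore]
    | mid i => fin_cases i <;> simp [hmid]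
    | leaf i => fin_cases i <;> simp [hleaf]

/-- `χ_la(Sp(2^[3])) = 4`. -/
theorem chiLA_spider2_three : chiLA (spider2 3) = 4 := by
  obtain ⟨f, hf, hle⟩ := exists_isLocalAntimagic_colorCount_le_four
  have hge {g} (hg : IsLocalAntimagic (spider2 3) g) : 4 ≤ colorCount (spider2 3) g :=
    succ_le_colorCount_spider2 (by norm_num) hg
  have hmem : 4 ∈ {n | ∃ g, IsLocalAntimagic (spider2 3) g ∧ colorCount (spider2 3) g = n} :=
    ⟨f, hf, le_antisymm hle (hge hf)⟩
  refine le_antisymm (Nat.sInf_le hmem) (le_csInf ⟨4, hmem⟩ ?_)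
  rintro _ ⟨g, hg, rfl⟩
  exact hge hg

end LocalAntimagic
end

section
/- Assume the standard setup with r ≥ 2, and let 1 ≤ i ≤ r. Assume e + s·nᵢ ≥ c_r if i < r and e + s·nᵢ ≥ c_{r−1} if i = r, where s ≥ 1 if nᵢ = 1 and s ≥ 2 is even if nᵢ ≥ 2. If e < c₁, then χ_la(G(Vᵢ,s)) = s·nᵢ + t − r + 1. -/
open Finset
open scoped Classical

namespace LocalAntimagic

variable {V : Type*}

/-- `G(S, s)`: the graph obtained from `G` by attaching `s` new pendant edges to every
vertex of `S`.  The new pendant vertex attached to `w ∈ S` via the `j`-th new edge is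
`Sum.inr (w, j)`; the original graph lives on the `Sum.inl` vertices. -/
def attachPendants (G : SimpleGraph V) (S : Finset V) (s : ℕ) :
    SimpleGraph (V ⊕ (S × Fin s)) :=
  SimpleGraph.fromRel (fun a b =>
    (∃ u v : V, a = Sum.inl u ∧ b = Sum.inl v ∧ G.Adj u v) ∨
    (∃ (w : S) (j : Fin s), a = Sum.inl (w : V) ∧ b = Sum.inr (w, j)))

/-- The standard setup: `G` is a connected graph with at least `2` edges and
`χ_la(G) = t ≥ 2`; `f` is a local antimagic labeling of `G` with `c(f) = t` whose color
classes are `Vset 1, …, Vset t` (each nonempty, with `f⁺ ≡ c i` on `Vset i`, and the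
colors `c 1, …, c t` pairwise distinct); every non-pendant vertex lies in
`Vset 1 ∪ ⋯ ∪ Vset r` where `1 ≤ r ≤ t`; each `Vset i` with `r + 1 ≤ i ≤ t` is a
singleton consisting of a pendant vertex; `c 1 < c 2 < ⋯ < c r` and
`c (r+1) < c (r+2) < ⋯ < c t`. -/
structure StandardSetup [Fintype V] (G : SimpleGraph V) (f : Sym2 V → ℕ)
    (t r : ℕ) (Vset : ℕ → Finset V) (c : ℕ → ℕ) : Prop where
  connected : G.Connected
  two_le_card_edges : 2 ≤ G.edgeFinset.card
  chiLA_eq : chiLA G = t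
  two_le_t : 2 ≤ t
  antimagic : IsLocalAntimagic G f
  colorCount_eq : colorCount G f = t
  color_on_class : ∀ i ∈ Finset.Icc 1 t, ∀ v ∈ Vset i, vertexSum G f v = c i
  class_cover : ∀ v : V, ∃ i ∈ Finset.Icc 1 t, v ∈ Vset i
  class_nonempty : ∀ i ∈ Finset.Icc 1 t, (Vset i).Nonempty
  color_injective : ∀ i ∈ Finset.Icc 1 t, ∀ j ∈ Finset.Icc 1 t, i ≠ j → c i ≠ c j
  one_le_r : 1 ≤ r
  r_le_t : r ≤ t
  nonpendant_mem : ∀ v : V, ¬ IsPendant G v → ∃ i ∈ Finset.Icc 1 r, v ∈ Vset i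
  pendant_singleton : ∀ i ∈ Finset.Icc (r + 1) t, ∃ v : V, IsPendant G v ∧ Vset i = {v}
  c_strictMono_low : ∀ i j : ℕ, 1 ≤ i → i < j → j ≤ r → c i < c j
  c_strictMono_high : ∀ i j : ℕ, r + 1 ≤ i → i < j → j ≤ t → c i < c j

/-- `b`: the number of pendant vertices of `G` lying in `Vset 1 ∪ ⋯ ∪ Vset r`. -/
noncomputable def pendantsInLow [Fintype V] (G : SimpleGraph V)
    (Vset : ℕ → Finset V) (r : ℕ) : ℕ :=
  (((Finset.Icc 1 r).biUnion Vset).filter (fun v => IsPendant G v)).card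

section General

variable [Fintype V] {G : SimpleGraph V} {f : Sym2 V → ℕ}

lemma vertexSum_eq_sum_ite (G : SimpleGraph V) (f : Sym2 V → ℕ) (v : V) :
    vertexSum G f v = ∑ u, if G.Adj v u then f s(v, u) else 0 := by
  rw [← Finset.sum_filter]
  unfold vertexSum
  symm
  refine Finset.sum_bij (fun u _ => s(v, u)) ?_ ?_ ?_ ?_
  · intro u hu
    simpa using hu
  · intro u _ w _ h
    exact Sym2.congr_right.1 h
  · intro a ha
    rw [SimpleGraph.mem_incidenceFinset] at ha
    obtain ⟨ha, hv⟩ := ha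
    obtain ⟨u, rfl⟩ := Sym2.mem_iff_exists.mp hv
    exact ⟨u, by simpa using ha, rfl⟩
  · intros
    rfl

lemma le_vertexSum_of_adj {u v : V} (h : G.Adj v u) : f s(v, u) ≤ vertexSum G f v := by
  unfold vertexSum
  refine Finset.single_le_sum (f := f) (fun _ _ => Nat.zero_le _) ?_
  simpa using h

lemma IsPendant.exists_adj {v : V} (h : IsPendant G v) :
    ∃ u, G.Adj v u ∧ ∀ f : Sym2 V → ℕ, vertexSum G f v = f s(v, u) := by
  unfold IsPendant at h
  rw [← SimpleGraph.card_neighborFinset_eq_degree, Finset.card_eq_one] at h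
  obtain ⟨u, hu⟩ := h
  have key : ∀ w, G.Adj v w ↔ w = u := by
    intro w
    rw [← SimpleGraph.mem_neighborFinset, hu, Finset.mem_singleton]
  exact ⟨u, (key u).2 rfl, fun f => by simp [vertexSum_eq_sum_ite, key]⟩

lemma isPendant_of_adj_iff {u v : V} (h : ∀ w, G.Adj v w ↔ w = u) : IsPendant G v := by
  unfold IsPendant
  rw [← SimpleGraph.card_neighborFinset_eq_degree, Finset.card_eq_one]
  exact ⟨u, by ext w; simp [h]⟩

lemma IsLocalAntimagic.label_le (hf : IsLocalAntimagic G f) {u v : V} (h : G.Adj u v) :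
    f s(u, v) ≤ G.edgeFinset.card :=
  (hf.1.mapsTo ((SimpleGraph.mem_edgeSet G).2 h)).2

lemma IsLocalAntimagic.vertexSum_le_of_isPendant (hf : IsLocalAntimagic G f) {v : V}
    (hv : IsPendant G v) : vertexSum G f v ≤ G.edgeFinset.card := by
  obtain ⟨u, hu, hs⟩ := hv.exists_adj
  exact hs f ▸ hf.label_le hu

/-- Distinct pendant vertices receive distinct colors. -/
lemma IsLocalAntimagic.vertexSum_injOn_isPendant (hf : IsLocalAntimagic G f) :
    Set.InjOn (vertexSum G f) {v | IsPendant G v} := by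
  intro v hv w hw h
  obtain ⟨v', hadj, hsv⟩ := IsPendant.exists_adj hv
  obtain ⟨w', hww', hsw⟩ := IsPendant.exists_adj hw
  have he := hf.1.injOn ((SimpleGraph.mem_edgeSet G).2 hadj)
    ((SimpleGraph.mem_edgeSet G).2 hww') (by rw [← hsv f, ← hsw f, h])
  rcases Sym2.eq_iff.mp he with ⟨h1, -⟩ | ⟨-, rfl⟩
  · exact h1
  · exact absurd h (hf.2 hadj)

/-- Besides the colors of the pendant vertices, a color exceeding every label is needed. -/
lemma IsLocalAntimagic.pendantCount_add_one_le (hf : IsLocalAntimagic G f)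
    (hG : 1 ≤ G.edgeFinset.card) : pendantCount G + 1 ≤ colorCount G f := by
  obtain ⟨x, hx⟩ : ∃ x, G.edgeFinset.card < vertexSum G f x := by
    obtain ⟨a, ha, hfa⟩ := hf.1.surjOn (Set.mem_Icc.2 ⟨hG, le_rfl⟩)
    induction a using Sym2.ind with
    | _ x y =>
      have hxy : G.Adj x y := by simpa using ha
      have h1 := le_vertexSum_of_adj (f := f) hxy
      have h2 := le_vertexSum_of_adj (f := f) hxy.symm
      rw [Sym2.eq_swap] at h2
      rcases lt_or_gt_of_ne (hf.2 hxy) with h | h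
      · exact ⟨y, by omega⟩
      · exact ⟨x, by omega⟩
  have hx' : vertexSum G f x ∉
      (Finset.univ.filter (fun v => IsPendant G v)).image (vertexSum G f) := by
    intro h
    obtain ⟨v, hv, hvx⟩ := Finset.mem_image.1 h
    have := hf.vertexSum_le_of_isPendant (Finset.mem_filter.1 hv).2
    omega
  unfold pendantCount colorCount
  rw [← Finset.card_image_of_injOn (s := Finset.univ.filter (fun v => IsPendant G v))
    (f := vertexSum G f) (hf.vertexSum_injOn_isPendant.mono (by intro v; simp)),
    ← Finset.card_insert_of_notMem hx']
  refine Finset.card_le_card ?_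
  intro y hy
  rcases Finset.mem_insert.1 hy with rfl | hy
  · exact Finset.mem_image_of_mem _ (Finset.mem_univ _)
  · exact Finset.image_subset_image (Finset.filter_subset _ _) hy

lemma card_edgeFinset_of_bijOn {q : ℕ} (h : Set.BijOn f G.edgeSet (Set.Icc 1 q)) :
    G.edgeFinset.card = q := by
  have h' : Set.BijOn f (G.edgeFinset : Set (Sym2 V)) (Finset.Icc 1 q : Finset ℕ) := by
    simpa using h
  have := Finset.card_bij (s := G.edgeFinset) (t := Finset.Icc 1 q) (fun a _ => f a)
    (fun a ha => h'.mapsTo ha) (fun a ha b hb hab => h'.injOn ha hb hab)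
    (fun b hb => by
      obtain ⟨a, ha, hab⟩ := h'.surjOn hb
      exact ⟨a, ha, hab⟩)
  simpa using this

end General

/-- The boustrophedon filling of a grid with `n` columns: even rows increase, odd rows decrease. -/
def snake (n k j : ℕ) : ℕ := j * n + (if Even j then k else n - 1 - k) + 1

lemma snake_mem_Icc {n s k j : ℕ} (hk : k < n) (hj : j < s) :
    snake n k j ∈ Finset.Icc 1 (s * n) := by
  have h : (j + 1) * n ≤ s * n := Nat.mul_le_mul_right _ hj
  rw [Nat.succ_mul] at h
  rw [Finset.mem_Icc]
  unfold snake
  split_ifs <;> omega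

lemma snake_injective {n k j k' j' : ℕ} (hk : k < n) (hk' : k' < n)
    (h : snake n k j = snake n k' j') : k = k' ∧ j = j' := by
  have hj : j = j' := by
    unfold snake at h
    rcases lt_trichotomy j j' with hlt | heq | hlt
    · have h1 : (j + 1) * n ≤ j' * n := Nat.mul_le_mul_right _ hlt
      rw [Nat.succ_mul] at h1
      split_ifs at h <;> omega
    · exact heq
    · have h1 : (j' + 1) * n ≤ j * n := Nat.mul_le_mul_right _ hlt
      rw [Nat.succ_mul] at h1
      split_ifs at h <;> omega
  subst hj
  unfold snake at h
  split_ifs at h <;> omega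

lemma sum_snake_eq {n k k' : ℕ} (hk : k < n) (hk' : k' < n) (m : ℕ) :
    ∑ j ∈ Finset.range (m + m), snake n k j = ∑ j ∈ Finset.range (m + m), snake n k' j := by
  induction m with
  | zero => simp
  | succ m ih =>
    have h2 : m + 1 + (m + 1) = m + m + 1 + 1 := by ring
    have he : Even (m + m) := ⟨m, rfl⟩
    have ho : ¬ Even (m + m + 1) := by simp [Nat.even_add_one]
    rw [h2]
    simp only [Finset.sum_range_succ, ih]
    simp only [snake, if_pos he, if_neg ho]
    omega

/-- A `κ × s` grid can be filled with `1, …, s * |κ|` so that all the sums over `Fin s` agree,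
if `|κ| = 1` or `s` is even. -/
lemma exists_balanced_filling {κ : Type*} [Fintype κ] {s : ℕ}
    (h : Fintype.card κ = 1 ∨ Even s) :
    ∃ p : κ × Fin s → ℕ, Function.Injective p ∧
      Set.range p = Set.Icc 1 (s * Fintype.card κ) ∧
      ∀ w w', ∑ j, p (w, j) = ∑ j, p (w', j) := by
  let φ := Fintype.equivFin κ
  let p : κ × Fin s → ℕ := fun x => snake (Fintype.card κ) (φ x.1) x.2
  have hinj : Function.Injective p := by
    rintro ⟨w, j⟩ ⟨w', j'⟩ hp
    obtain ⟨h1, h2⟩ := snake_injective (φ w).2 (φ w').2 hp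
    exact Prod.ext (φ.injective (Fin.ext h1)) (Fin.ext h2)
  refine ⟨p, hinj, ?_, ?_⟩
  · have himg : Finset.univ.image p = Finset.Icc 1 (s * Fintype.card κ) := by
      refine Finset.eq_of_subset_of_card_le ?_ ?_
      · intro y hy
        obtain ⟨x, -, rfl⟩ := Finset.mem_image.1 hy
        exact snake_mem_Icc (φ x.1).2 x.2.2
      · rw [Finset.card_image_of_injective _ hinj]
        simp [mul_comm]
    rw [← Finset.coe_Icc, ← himg]
    simp
  · intro w w'
    rcases h with h | ⟨m, rfl⟩
    · have := Fintype.card_le_one_iff_subsingleton.1 h.le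
      rw [Subsingleton.elim w w']
    · change ∑ j : Fin (m + m), snake _ (φ w) j = ∑ j : Fin (m + m), snake _ (φ w') j
      rw [Fin.sum_univ_eq_sum_range (fun j => snake (Fintype.card κ) (φ w) j),
        Fin.sum_univ_eq_sum_range (fun j => snake (Fintype.card κ) (φ w') j)]
      exact sum_snake_eq (φ w).2 (φ w').2 m

section Attach

variable {G : SimpleGraph V} {S : Finset V} {s : ℕ}

@[simp]
lemma attachPendants_adj_inl_inl {u v : V} :
    (attachPendants G S s).Adj (Sum.inl u) (Sum.inl v) ↔ G.Adj u v := by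
  simp only [attachPendants, SimpleGraph.fromRel_adj]
  constructor
  · rintro ⟨-, h⟩
    rcases h with (⟨a, b, ha, hb, h⟩ | ⟨a, b, -, hb⟩) | (⟨a, b, ha, hb, h⟩ | ⟨a, b, -, hb⟩)
    · cases ha; cases hb; exact h
    · cases hb
    · cases ha; cases hb; exact h.symm
    · cases hb
  · intro h
    exact ⟨fun h' => h.ne (Sum.inl_injective h'), Or.inl (Or.inl ⟨u, v, rfl, rfl, h⟩)⟩

@[simp]
lemma attachPendants_adj_inl_inr {u : V} {x : S × Fin s} :
    (attachPendants G S s).Adj (Sum.inl u) (Sum.inr x) ↔ (x.1 : V) = u := by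
  simp only [attachPendants, SimpleGraph.fromRel_adj]
  constructor
  · rintro ⟨-, h⟩
    rcases h with (⟨a, b, ha, hb, h⟩ | ⟨a, b, ha, hb⟩) | (⟨a, b, ha, hb, h⟩ | ⟨a, b, ha, hb⟩)
    · cases hb
    · cases ha; cases hb; rfl
    · cases ha
    · cases hb
  · rintro rfl
    exact ⟨by simp, Or.inl (Or.inr ⟨x.1, x.2, rfl, rfl⟩)⟩

@[simp]
lemma attachPendants_adj_inr_inl {u : V} {x : S × Fin s} :
    (attachPendants G S s).Adj (Sum.inr x) (Sum.inl u) ↔ (x.1 : V) = u := by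
  rw [SimpleGraph.adj_comm, attachPendants_adj_inl_inr]

@[simp]
lemma not_attachPendants_adj_inr_inr {x y : S × Fin s} :
    ¬ (attachPendants G S s).Adj (Sum.inr x) (Sum.inr y) := by
  simp [attachPendants, SimpleGraph.fromRel_adj]

/-- The labeling of `attachPendants G S s` given by `f` on the edges of `G` and by `p` on the
new pendant edges. -/
def extendLabel (f : Sym2 V → ℕ) (p : S × Fin s → ℕ) : Sym2 (V ⊕ (S × Fin s)) → ℕ :=
  Sym2.lift ⟨fun a b => match a, b with
    | Sum.inl u, Sum.inl v => f s(u, v)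
    | Sum.inl _, Sum.inr x => p x
    | Sum.inr x, Sum.inl _ => p x
    | Sum.inr _, Sum.inr _ => 0, by
      rintro (u | x) (v | y)
      · exact congrArg f Sym2.eq_swap
      all_goals rfl⟩

@[simp]
lemma extendLabel_inl_inl (f : Sym2 V → ℕ) (p : S × Fin s → ℕ) (u v : V) :
    extendLabel f p s(Sum.inl u, Sum.inl v) = f s(u, v) := rfl

@[simp]
lemma extendLabel_inl_inr (f : Sym2 V → ℕ) (p : S × Fin s → ℕ) (u : V) (x : S × Fin s) :
    extendLabel f p s(Sum.inl u, Sum.inr x) = p x := rfl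

@[simp]
lemma extendLabel_inr_inl (f : Sym2 V → ℕ) (p : S × Fin s → ℕ) (u : V) (x : S × Fin s) :
    extendLabel f p s(Sum.inr x, Sum.inl u) = p x := rfl

lemma mem_edgeSet_attachPendants {a : Sym2 (V ⊕ (S × Fin s))}
    (ha : a ∈ (attachPendants G S s).edgeSet) :
    (∃ u v, G.Adj u v ∧ a = s(Sum.inl u, Sum.inl v)) ∨
      ∃ x : S × Fin s, a = s(Sum.inl (x.1 : V), Sum.inr x) := by
  induction a using Sym2.ind with
  | _ a b =>
    rw [SimpleGraph.mem_edgeSet] at ha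
    rcases a with u | x <;> rcases b with v | y
    · exact Or.inl ⟨u, v, by simpa using ha, rfl⟩
    · rw [attachPendants_adj_inl_inr] at ha
      exact Or.inr ⟨y, by rw [ha]⟩
    · rw [attachPendants_adj_inr_inl] at ha
      exact Or.inr ⟨x, by rw [ha, Sym2.eq_swap]⟩
    · exact absurd ha not_attachPendants_adj_inr_inr

lemma bijOn_extendLabel {f : Sym2 V → ℕ} {p : S × Fin s → ℕ} {e m : ℕ}
    (hf : Set.BijOn f G.edgeSet (Set.Icc 1 e)) (hp : Function.Injective p)
    (hr : Set.range p = Set.Icc (e + 1) (e + m)) :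
    Set.BijOn (extendLabel f p) (attachPendants G S s).edgeSet (Set.Icc 1 (e + m)) := by
  have hf1 : ∀ {u v}, G.Adj u v → 1 ≤ f s(u, v) ∧ f s(u, v) ≤ e := fun h =>
    hf.mapsTo ((SimpleGraph.mem_edgeSet G).2 h)
  have hp1 : ∀ x, e + 1 ≤ p x ∧ p x ≤ e + m := fun x => by
    rw [← Set.mem_Icc, ← hr]
    exact Set.mem_range_self x
  refine ⟨?_, ?_, ?_⟩
  · intro a ha
    rcases mem_edgeSet_attachPendants ha with ⟨u, v, h, rfl⟩ | ⟨x, rfl⟩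
    · have := hf1 h
      simp only [extendLabel_inl_inl, Set.mem_Icc]
      omega
    · have := hp1 x
      simp only [extendLabel_inl_inr, Set.mem_Icc]
      omega
  · intro a ha b hb hab
    rcases mem_edgeSet_attachPendants ha with ⟨u, v, h, rfl⟩ | ⟨x, rfl⟩ <;>
    rcases mem_edgeSet_attachPendants hb with ⟨u', v', h', rfl⟩ | ⟨y, rfl⟩ <;>
    simp only [extendLabel_inl_inl, extendLabel_inl_inr] at hab
    · have := hf.injOn ((SimpleGraph.mem_edgeSet G).2 h) ((SimpleGraph.mem_edgeSet G).2 h') hab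
      exact congrArg (Sym2.map (Sum.inl : V → V ⊕ (S × Fin s))) this
    · have := hf1 h
      have := hp1 y
      omega
    · have := hf1 h'
      have := hp1 x
      omega
    · rw [hp hab]
  · rintro y ⟨h1, h2⟩
    by_cases hy : y ≤ e
    · obtain ⟨a, ha, rfl⟩ := hf.surjOn ⟨h1, hy⟩
      induction a using Sym2.ind with
      | _ u v =>
        refine ⟨s(Sum.inl u, Sum.inl v), ?_, rfl⟩
        simpa using ha
    · obtain ⟨x, rfl⟩ : y ∈ Set.range p := by
        rw [hr]
        exact ⟨by omega, h2⟩
      exact ⟨s(Sum.inl (x.1 : V), Sum.inr x), by simp, rfl⟩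

variable [Fintype V]

lemma vertexSum_extendLabel_inr (f : Sym2 V → ℕ) (p : S × Fin s → ℕ) (x : S × Fin s) :
    vertexSum (attachPendants G S s) (extendLabel f p) (Sum.inr x) = p x := by
  simp [vertexSum_eq_sum_ite]

lemma vertexSum_extendLabel_inl_of_notMem (f : Sym2 V → ℕ) (p : S × Fin s → ℕ) {v : V}
    (hv : v ∉ S) :
    vertexSum (attachPendants G S s) (extendLabel f p) (Sum.inl v) = vertexSum G f v := by
  have h : ∀ x : S × Fin s, (x.1 : V) ≠ v := fun x hx => hv (hx ▸ x.1.2)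
  simp [vertexSum_eq_sum_ite, h]

lemma vertexSum_extendLabel_inl_of_mem (f : Sym2 V → ℕ) (p : S × Fin s → ℕ) (w : S) :
    vertexSum (attachPendants G S s) (extendLabel f p) (Sum.inl (w : V)) =
      vertexSum G f w + ∑ j, p (w, j) := by
  rw [vertexSum_eq_sum_ite, vertexSum_eq_sum_ite, Fintype.sum_sum_type, Fintype.sum_prod_type]
  simp only [attachPendants_adj_inl_inl, extendLabel_inl_inl, attachPendants_adj_inl_inr,
    extendLabel_inl_inr]
  congr 1
  rw [Finset.sum_eq_single w]
  · simp
  · intro b _ hb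
    have : (b : V) ≠ w := fun h => hb (Subtype.ext h)
    simp [this]
  · simp

lemma isPendant_attachPendants_inr (x : S × Fin s) :
    IsPendant (attachPendants G S s) (Sum.inr x) := by
  refine isPendant_of_adj_iff (u := Sum.inl (x.1 : V)) ?_
  rintro (w | y)
  · simp [eq_comm]
  · simp

lemma IsPendant.attachPendants_inl {v : V} (h : IsPendant G v) (hv : v ∉ S) :
    IsPendant (attachPendants G S s) (Sum.inl v) := by
  unfold IsPendant at h
  rw [← SimpleGraph.card_neighborFinset_eq_degree, Finset.card_eq_one] at h
  obtain ⟨u, hu⟩ := h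
  refine isPendant_of_adj_iff (u := Sum.inl u) ?_
  rintro (w | y)
  · rw [attachPendants_adj_inl_inl, ← SimpleGraph.mem_neighborFinset, hu, Finset.mem_singleton,
      Sum.inl.injEq]
  · have : (y.1 : V) ≠ v := fun hx => hv (hx ▸ y.1.2)
    simp [this]

lemma le_pendantCount_attachPendants {T : Finset V} (hT : ∀ v ∈ T, IsPendant G v)
    (hTS : Disjoint T S) : s * S.card + T.card ≤ pendantCount (attachPendants G S s) := by
  have hcard : (T.disjSum (Finset.univ : Finset (S × Fin s))).card = s * S.card + T.card := by
    simp [Finset.card_disjSum]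
    ring
  rw [← hcard]
  refine Finset.card_le_card ?_
  rintro (v | x) hx
  · have hv : v ∈ T := by simpa using hx
    simpa using (hT v hv).attachPendants_inl (Finset.disjoint_left.1 hTS hv)
  · simpa using isPendant_attachPendants_inr x

end Attach

namespace StandardSetup

variable [Fintype V] {G : SimpleGraph V} {f : Sym2 V → ℕ} {t r : ℕ}
  {Vset : ℕ → Finset V} {c : ℕ → ℕ}

lemma index_unique (h : StandardSetup G f t r Vset c) {i j : ℕ} (hi : i ∈ Finset.Icc 1 t)
    (hj : j ∈ Finset.Icc 1 t) {v : V} (hvi : v ∈ Vset i) (hvj : v ∈ Vset j) : i = j := by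
  by_contra hij
  exact h.color_injective i hi j hj hij
    ((h.color_on_class i hi v hvi).symm.trans (h.color_on_class j hj v hvj))

lemma exists_pendant_finset (h : StandardSetup G f t r Vset c) {i : ℕ} (hi₁ : 1 ≤ i)
    (hi₂ : i ≤ r) :
    ∃ T : Finset V, (∀ v ∈ T, IsPendant G v) ∧ Disjoint T (Vset i) ∧ t - r ≤ T.card := by
  have hrt := h.r_le_t
  have := h.connected.nonempty
  choose! p hp hV using h.pendant_singleton
  have hmem : ∀ j ∈ Finset.Icc (r + 1) t, p j ∈ Vset j := fun j hj => by
    rw [hV j hj]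
    exact Finset.mem_singleton_self _
  have hIcc : ∀ j ∈ Finset.Icc (r + 1) t, j ∈ Finset.Icc 1 t := fun j hj => by
    rw [Finset.mem_Icc] at hj ⊢
    omega
  refine ⟨(Finset.Icc (r + 1) t).image p, ?_, ?_, ?_⟩
  · intro v hv
    obtain ⟨j, hj, rfl⟩ := Finset.mem_image.1 hv
    exact hp j hj
  · rw [Finset.disjoint_left]
    intro v hv hvi
    obtain ⟨j, hj, rfl⟩ := Finset.mem_image.1 hv
    have := h.index_unique (hIcc j hj) (Finset.mem_Icc.2 ⟨hi₁, hi₂.trans hrt⟩) (hmem j hj) hvi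
    rw [Finset.mem_Icc] at hj
    omega
  · rw [Finset.card_image_of_injOn]
    · simp
    · intro j hj k hk hjk
      exact h.index_unique (hIcc j hj) (hIcc k hk) (hmem j hj) (hjk ▸ hmem k hk)

lemma color_le_of_high (h : StandardSetup G f t r Vset c) {j : ℕ}
    (hj : j ∈ Finset.Icc (r + 1) t) : c j ≤ G.edgeFinset.card := by
  obtain ⟨v, hv, hV⟩ := h.pendant_singleton j hj
  have hj' : j ∈ Finset.Icc 1 t := by
    rw [Finset.mem_Icc] at hj ⊢
    omega
  rw [← h.color_on_class j hj' v (by rw [hV]; exact Finset.mem_singleton_self _)]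
  exact h.antimagic.vertexSum_le_of_isPendant hv

lemma color_one_le (h : StandardSetup G f t r Vset c) {j : ℕ} (hj₁ : 1 ≤ j) (hj₂ : j ≤ r) :
    c 1 ≤ c j := by
  rcases hj₁.eq_or_lt with rfl | hlt
  · exact le_rfl
  · exact (h.c_strictMono_low 1 j le_rfl hlt hj₂).le

/-- If every low color except `c i` lies in `(e, e + s * nᵢ]`, a balanced labeling of the new
pendant edges creates a single color beyond the labels of the pendant edges. -/
lemma exists_labeling (h : StandardSetup G f t r Vset c) {i s : ℕ} (hi₁ : 1 ≤ i)
    (hi₂ : i ≤ r) (hs : (Vset i).card = 1 ∨ Even s) (hs₀ : 1 ≤ s)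
    (hlow : G.edgeFinset.card < c 1)
    (hbig : ∀ j, 1 ≤ j → j ≤ r → j ≠ i → c j ≤ G.edgeFinset.card + s * (Vset i).card) :
    ∃ g, IsLocalAntimagic (attachPendants G (Vset i) s) g ∧
      (attachPendants G (Vset i) s).edgeFinset.card =
        G.edgeFinset.card + s * (Vset i).card ∧
      colorCount (attachPendants G (Vset i) s) g ≤ s * (Vset i).card + (t - r) + 1 := by
  have hrt := h.r_le_t
  have hit : i ∈ Finset.Icc 1 t := Finset.mem_Icc.2 ⟨hi₁, hi₂.trans hrt⟩
  have hci := h.color_one_le hi₁ hi₂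
  set S := Vset i
  set e := G.edgeFinset.card
  obtain ⟨w₀, hw₀⟩ := h.class_nonempty i hit
  have hcard : 1 ≤ S.card := Finset.card_pos.2 ⟨w₀, hw₀⟩
  have hsS : 1 ≤ s * S.card := Nat.mul_pos hs₀ hcard
  obtain ⟨p₀, hinj₀, hrange₀, hsum₀⟩ :=
    exists_balanced_filling (κ := S) (s := s) (by simpa using hs)
  rw [Fintype.card_coe] at hrange₀
  let p : S × Fin s → ℕ := fun x => e + p₀ x
  have hinj : Function.Injective p := fun x y hxy => hinj₀ (Nat.add_left_cancel hxy)
  have hmem₀ : ∀ x, p₀ x ∈ Set.Icc 1 (s * S.card) := fun x => by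
    rw [← hrange₀]
    exact Set.mem_range_self x
  have hrange : Set.range p = Set.Icc (e + 1) (e + s * S.card) := by
    ext y
    constructor
    · rintro ⟨x, rfl⟩
      obtain ⟨h1, h2⟩ := hmem₀ x
      exact ⟨Nat.add_le_add_left h1 e, Nat.add_le_add_left h2 e⟩
    · rintro ⟨h1, h2⟩
      obtain ⟨x, hx⟩ : y - e ∈ Set.range p₀ := by
        rw [hrange₀]
        exact ⟨by omega, by omega⟩
      exact ⟨x, by change e + p₀ x = y; omega⟩
  have hpmem : ∀ x, e + 1 ≤ p x ∧ p x ≤ e + s * S.card := fun x => by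
    rw [← Set.mem_Icc, ← hrange]
    exact Set.mem_range_self x
  obtain ⟨σ, hσ⟩ : ∃ σ, ∀ w : S, ∑ j, p (w, j) = σ :=
    ⟨∑ j, p (⟨w₀, hw₀⟩, j), fun w => by
      simp only [p, Finset.sum_add_distrib, hsum₀ w ⟨w₀, hw₀⟩]⟩
  have hσq : e + s * S.card ≤ σ := by
    obtain ⟨⟨w, j⟩, hx⟩ : e + s * S.card ∈ Set.range p := by
      rw [hrange]
      exact ⟨by omega, le_rfl⟩
    rw [← hx, ← hσ w]
    exact Finset.single_le_sum (f := fun j => p (w, j)) (fun _ _ => Nat.zero_le _)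
      (Finset.mem_univ j)
  have hbij := bijOn_extendLabel (G := G) h.antimagic.1 hinj hrange
  have hq := card_edgeFinset_of_bijOn hbij
  set H := attachPendants G S s with hH
  set g := extendLabel f p with hg
  have hsumS : ∀ v ∈ S, vertexSum H g (Sum.inl v) = c i + σ := fun v hv => by
    rw [hH, hg, vertexSum_extendLabel_inl_of_mem f p ⟨v, hv⟩, hσ,
      h.color_on_class i hit v hv]
  have hcolor : ∀ v ∉ S, vertexSum G f v ∈ (Finset.Icc (r + 1) t).image c ∪
      Finset.Icc (e + 1) (e + s * S.card) := fun v hv => by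
    obtain ⟨j, hj, hvj⟩ := h.class_cover v
    rw [h.color_on_class j hj v hvj]
    rw [Finset.mem_Icc] at hj
    by_cases hjr : j ≤ r
    · have h1 := h.color_one_le hj.1 hjr
      have h2 := hbig j hj.1 hjr (by rintro rfl; exact hv hvj)
      exact Finset.mem_union_right _ (Finset.mem_Icc.2 ⟨by omega, h2⟩)
    · exact Finset.mem_union_left _
        (Finset.mem_image_of_mem _ (Finset.mem_Icc.2 ⟨by omega, hj.2⟩))
  have hle : ∀ v ∉ S, vertexSum H g (Sum.inl v) < c i + σ := fun v hv => by
    rw [hH, hg, vertexSum_extendLabel_inl_of_notMem f p hv]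
    rcases Finset.mem_union.1 (hcolor v hv) with h1 | h1
    · obtain ⟨j, hj, hjc⟩ := Finset.mem_image.1 h1
      have := h.color_le_of_high hj
      omega
    · rw [Finset.mem_Icc] at h1
      omega
  have hinr : ∀ x, vertexSum H g (Sum.inr x) = p x := vertexSum_extendLabel_inr f p
  refine ⟨g, ⟨by rw [hq]; exact hbij, ?_⟩, hq, ?_⟩
  · rintro (u | x) (v | y) hadj
    · rw [hH, attachPendants_adj_inl_inl] at hadj
      have hne := h.antimagic.2 hadj
      by_cases hu : u ∈ S <;> by_cases hv : v ∈ S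
      · exact absurd ((h.color_on_class i hit u hu).trans
          (h.color_on_class i hit v hv).symm) hne
      · rw [hsumS u hu]
        exact (hle v hv).ne'
      · rw [hsumS v hv]
        exact (hle u hu).ne
      · rwa [hH, hg, vertexSum_extendLabel_inl_of_notMem f p hu,
          vertexSum_extendLabel_inl_of_notMem f p hv]
    · rw [hH, attachPendants_adj_inl_inr] at hadj
      have := hpmem y
      rw [hinr, hsumS u (hadj ▸ y.1.2)]
      omega
    · rw [hH, attachPendants_adj_inr_inl] at hadj
      have := hpmem x
      rw [hinr, hsumS v (hadj ▸ x.1.2)]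
      omega
    · exact absurd hadj not_attachPendants_adj_inr_inr
  · have hsub : Finset.univ.image (vertexSum H g) ⊆ insert (c i + σ)
        ((Finset.Icc (r + 1) t).image c ∪ Finset.Icc (e + 1) (e + s * S.card)) := by
      intro y hy
      obtain ⟨v | x, -, rfl⟩ := Finset.mem_image.1 hy
      · by_cases hv : v ∈ S
        · rw [hsumS v hv]
          exact Finset.mem_insert_self _ _
        · rw [hH, hg, vertexSum_extendLabel_inl_of_notMem f p hv]
          exact Finset.mem_insert_of_mem (hcolor v hv)
      · rw [hinr]
        exact Finset.mem_insert_of_mem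
          (Finset.mem_union_right _ (Finset.mem_Icc.2 (hpmem x)))
    have h1 := Finset.card_insert_le (c i + σ)
      ((Finset.Icc (r + 1) t).image c ∪ Finset.Icc (e + 1) (e + s * S.card))
    have h2 := Finset.card_union_le ((Finset.Icc (r + 1) t).image c)
      (Finset.Icc (e + 1) (e + s * S.card))
    have h3 := Finset.card_image_le (s := Finset.Icc (r + 1) t) (f := c)
    have h4 := Finset.card_le_card hsub
    rw [Nat.card_Icc] at h2 h3
    unfold colorCount
    omega

end StandardSetup

/-- Theorem 2.1(1): in the standard setup with `r ≥ 2`, for `1 ≤ i ≤ r`,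
if `e + s·nᵢ ≥ c_r` when `i < r` and `e + s·nᵢ ≥ c_{r-1}` when `i = r`, where `s ≥ 1`
if `nᵢ = 1` and `s ≥ 2` is even if `nᵢ ≥ 2`, and `e < c₁`, then
`χ_la(G(Vᵢ, s)) = s·nᵢ + t - r + 1`. -/
theorem chiLA_attachPendants_of_lt_c_one [Fintype V] (G : SimpleGraph V)
    (f : Sym2 V → ℕ) (t r : ℕ) (Vset : ℕ → Finset V) (c : ℕ → ℕ)
    (setup : StandardSetup G f t r Vset c) (hr : 2 ≤ r)
    (e s i : ℕ) (he : G.edgeFinset.card = e)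
    (hi₁ : 1 ≤ i) (hi₂ : i ≤ r)
    (hbig₁ : i < r → c r ≤ e + s * (Vset i).card)
    (hbig₂ : i = r → c (r - 1) ≤ e + s * (Vset i).card)
    (hs₁ : (Vset i).card = 1 → 1 ≤ s)
    (hs₂ : 2 ≤ (Vset i).card → 2 ≤ s ∧ Even s)
    (hec : e < c 1) :
    chiLA (attachPendants G (Vset i) s) = s * (Vset i).card + (t - r) + 1 := by
  subst he
  have hrt := setup.r_le_t
  have hcard : 1 ≤ (Vset i).card :=
    Finset.card_pos.2 (setup.class_nonempty i (Finset.mem_Icc.2 ⟨hi₁, hi₂.trans hrt⟩))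
  have hs : ((Vset i).card = 1 ∨ Even s) ∧ 1 ≤ s := by
    rcases hcard.eq_or_lt with h | h
    · exact ⟨Or.inl h.symm, hs₁ h.symm⟩
    · exact ⟨Or.inr (hs₂ h).2, by have := (hs₂ h).1; omega⟩
  have hbig : ∀ j, 1 ≤ j → j ≤ r → j ≠ i →
      c j ≤ G.edgeFinset.card + s * (Vset i).card := by
    intro j hj₁ hj₂ hji
    have hmono : ∀ k, j ≤ k → k ≤ r → c j ≤ c k := fun k hjk hk => by
      rcases hjk.eq_or_lt with rfl | hlt
      · exact le_rfl
      · exact (setup.c_strictMono_low j k hj₁ hlt hk).le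
    rcases hi₂.eq_or_lt with h | h
    · exact (hmono (r - 1) (by omega) (by omega)).trans (hbig₂ h)
    · exact (hmono r hj₂ le_rfl).trans (hbig₁ h)
  obtain ⟨g, hg, hq, hle⟩ := setup.exists_labeling hi₁ hi₂ hs.1 hs.2 hec hbig
  obtain ⟨T, hT, hdisj, hTcard⟩ := setup.exists_pendant_finset hi₁ hi₂
  have hpend := le_pendantCount_attachPendants (s := s) hT hdisj
  have hlower : ∀ g', IsLocalAntimagic (attachPendants G (Vset i) s) g' →
      s * (Vset i).card + (t - r) + 1 ≤ colorCount (attachPendants G (Vset i) s) g' := by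
    intro g' hg'
    have he := setup.two_le_card_edges
    have := hg'.pendantCount_add_one_le (by rw [hq]; omega)
    omega
  have hne : {n | ∃ g', IsLocalAntimagic (attachPendants G (Vset i) s) g' ∧
      colorCount (attachPendants G (Vset i) s) g' = n}.Nonempty := ⟨_, g, hg, rfl⟩
  obtain ⟨g', hg', hmin⟩ := Nat.sInf_mem hne
  refine le_antisymm (le_trans (Nat.sInf_le ?_) hle) ((hlower g' hg').trans hmin.le)
  exact ⟨g, hg, rfl⟩

end LocalAntimagic
end
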